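/- arXiv:1210.6256 — 2 statements merged into one kernel-verified Lean document; each statement's English description precedes it below -/
import Mathlib

section
/- Let K be a nondegenerate tetrahedron in ℝ³ and let τ ∈ Σ_K satisfy div τ ∈ 𝕋(K), where div τ is the row-wise divergence. If ∫_f τ n_f · v ds = 0 for every face f of K and every v ∈ P₁(f; ℝ³), then τ = 0 identically on K. (Unisolvence of the face degrees of freedom for the reduced shape function space Σ̃_K = { τ ∈ Σ_K : div τ ∈ 𝕋(K) }.) -/
open MeasureTheory RealInnerProductSpace Matrix

noncomputable section

abbrev E3 := EuclideanSpace ℝ (Fin 3)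

/-- `p` is (the restriction of) a real polynomial of total degree ≤ k on ℝ³. -/
def IsPolyLE (k : ℕ) (p : E3 → ℝ) : Prop :=
  ∃ P : MvPolynomial (Fin 3) ℝ, P.totalDegree ≤ k ∧ ∀ x, p x = MvPolynomial.eval (fun i => x i) P

/-- `p` agrees with an affine function on the set `s`. -/
def AffineOn (s : Set E3) (p : E3 → ℝ) : Prop :=
  ∃ q : E3 →ᵃ[ℝ] ℝ, ∀ x ∈ s, p x = q x

def Tet (v : Fin 4 → E3) : Set E3 := convexHull ℝ (Set.range v)

def Face (v : Fin 4 → E3) (i : Fin 4) : Set E3 := convexHull ℝ (v '' {j | j ≠ i})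

def Edge (v : Fin 4 → E3) (k l : Fin 4) : Set E3 := segment ℝ (v k) (v l)

/-- The matrix of the orthogonal projection `Q_u = I - u uᵀ` onto the plane `u^⊥`. -/
def Qmat (u : E3) : Matrix (Fin 3) (Fin 3) ℝ :=
  1 - Matrix.vecMulVec (fun i => u i) (fun i => u i)

/-- Membership in the shape-function space
`Σ_K = {σ ∈ P₂(K;𝕊) : Q_{s_e} σ Q_{s_e}|_e ∈ P₁(e;𝕊) for every edge e of K}`. -/
def MemSigmaK (v : Fin 4 → E3) (σ : E3 → Matrix (Fin 3) (Fin 3) ℝ) : Prop :=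
  (∀ i j : Fin 3, IsPolyLE 2 (fun x => σ x i j)) ∧
  (∀ x ∈ Tet v, (σ x).IsSymm) ∧
  (∀ k l : Fin 4, k ≠ l → ∀ s : E3, ‖s‖ = 1 → (∃ c : ℝ, v l - v k = c • s) →
    ∀ i j : Fin 3, AffineOn (Edge v k l) (fun x => (Qmat s * σ x * Qmat s) i j))

/-- `n` is the outward unit normal to the face of the tetrahedron with vertices `v`
opposite the vertex `v i`. -/
def IsOutwardNormal (v : Fin 4 → E3) (i : Fin 4) (n : E3) : Prop :=
  ‖n‖ = 1 ∧ (∀ j k : Fin 4, j ≠ i → k ≠ i → ⟪v j - v k, n⟫ = 0) ∧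
  (∀ j : Fin 4, j ≠ i → ⟪v i - v j, n⟫ < 0)

/-- The row-wise divergence of a matrix field. -/
def divRow (τ : E3 → Matrix (Fin 3) (Fin 3) ℝ) (r : Fin 3) (x : E3) : ℝ :=
  ∑ m : Fin 3, fderiv ℝ (fun y => τ y r m) x (EuclideanSpace.single m 1)

/-- `u` coincides on `s` with a rigid motion `x ↦ a + b × x`. -/
def IsRigidOn (s : Set E3) (u : E3 → (Fin 3 → ℝ)) : Prop :=
  ∃ a b : Fin 3 → ℝ, ∀ x ∈ s, u x = a + crossProduct b (fun m => x m)

lemma quad_prod (f g l : Fin 4 → ℝ) (hl : ∑ a, l a = 1) :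
    (∑ a, l a * f a) * (∑ a, l a * g a) = ∑ a, l a * (f a * g a) +
      ∑ k, ∑ m, l k * l m * (2 * ((1/2 * (f k + f m)) * (1/2 * (g k + g m))) - f k * g k - f m * g m) := by
  simp only [Fin.sum_univ_four] at *
  have : l 0 = 1 - l 1 - l 2 - l 3 := by linarith
  rw [this]; ring

lemma quad_formula (q : E3 → ℝ) (hq : IsPolyLE 2 q) (v : Fin 4 → E3) (l : Fin 4 → ℝ)
    (hl : ∑ a, l a = 1) :
    q (∑ a, l a • v a) = ∑ a, l a * q (v a) +
      ∑ k, ∑ m, l k * l m * (2 * q ((1/2 : ℝ) • (v k + v m)) - q (v k) - q (v m)) := by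
  obtain ⟨P, hP, hq⟩ := hq
  have key : ∀ d ∈ P.support, ∃ f g : E3 → ℝ, (∀ x : E3, ∏ i, x i ^ d i = f x * g x) ∧
      (f (∑ a, l a • v a) = ∑ a, l a * f (v a)) ∧ (g (∑ a, l a • v a) = ∑ a, l a * g (v a)) ∧
      (∀ x y, f ((1/2:ℝ) • (x + y)) = 1/2 * (f x + f y)) ∧
      (∀ x y, g ((1/2:ℝ) • (x + y)) = 1/2 * (g x + g y)) := by
    intro d hd
    have h1 := (MvPolynomial.le_totalDegree hd).trans hP
    rw [Finsupp.sum_fintype _ _ (fun _ => rfl), Fin.sum_univ_three] at h1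
    have hc : ∀ i : Fin 3, ((fun x : E3 => x i) (∑ a, l a • v a) = ∑ a, l a * (fun x : E3 => x i) (v a)) ∧
        (∀ x y, (fun x : E3 => x i) ((1/2:ℝ) • (x + y)) = 1/2 * ((fun x : E3 => x i) x + (fun x : E3 => x i) y)) := by
      intro i
      constructor
      · simp
      · intro x y; simp; ring
    have ho : ((fun _ : E3 => (1:ℝ)) (∑ a, l a • v a) = ∑ a, l a * (fun _ : E3 => (1:ℝ)) (v a)) ∧
        (∀ x y, (fun _ : E3 => (1:ℝ)) ((1/2:ℝ) • (x + y)) = 1/2 * ((fun _ : E3 => (1:ℝ)) x + (fun _ : E3 => (1:ℝ)) y)) := by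
      constructor
      · simp [hl]
      · intro x y; norm_num
    have fin : ∀ f g : E3 → ℝ, (∀ x : E3, ∏ i, x i ^ d i = f x * g x) → 
        ((f (∑ a, l a • v a) = ∑ a, l a * f (v a)) ∧ (∀ x y, f ((1/2:ℝ) • (x + y)) = 1/2 * (f x + f y))) →
        ((g (∑ a, l a • v a) = ∑ a, l a * g (v a)) ∧ (∀ x y, g ((1/2:ℝ) • (x + y)) = 1/2 * (g x + g y))) →
       ∃ f g : E3 → ℝ, (∀ x : E3, ∏ i, x i ^ d i = f x * g x) ∧
      (f (∑ a, l a • v a) = ∑ a, l a * f (v a)) ∧ (g (∑ a, l a • v a) = ∑ a, l a * g (v a)) ∧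
      (∀ x y, f ((1/2:ℝ) • (x + y)) = 1/2 * (f x + f y)) ∧
      (∀ x y, g ((1/2:ℝ) • (x + y)) = 1/2 * (g x + g y)) :=
      fun f g h1 h2 h3 => ⟨f, g, h1, h2.1, h3.1, h2.2, h3.2⟩
    simp only [Fin.prod_univ_three] at fin ⊢
    generalize d 0 = a at *
    generalize d 1 = b at *
    generalize d 2 = c at *
    have ha : a ≤ 2 := by omega
    have hb : b ≤ 2 := by omega
    have hc' : c ≤ 2 := by omega
    interval_cases a <;> interval_cases b <;> interval_cases c <;> first
      | omega
      | (refine fin (fun _ => 1) (fun _ => 1) ?_ ho ho; intro x; simp; done)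
      | (refine fin (fun _ => 1) (fun x : E3 => x 0) ?_ ho (hc 0); intro x; simp; done)
      | (refine fin (fun _ => 1) (fun x : E3 => x 1) ?_ ho (hc 1); intro x; simp; done)
      | (refine fin (fun _ => 1) (fun x : E3 => x 2) ?_ ho (hc 2); intro x; simp; done)
      | (refine fin (fun x : E3 => x 0) (fun x : E3 => x 1) ?_ (hc 0) (hc 1); intro x; simp; done)
      | (refine fin (fun x : E3 => x 0) (fun x : E3 => x 2) ?_ (hc 0) (hc 2); intro x; simp; done)
      | (refine fin (fun x : E3 => x 1) (fun x : E3 => x 2) ?_ (hc 1) (hc 2); intro x; simp; done)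
      | (refine fin (fun x : E3 => x 0) (fun x : E3 => x 0) ?_ (hc 0) (hc 0); intro x; simp [pow_two]; done)
      | (refine fin (fun x : E3 => x 1) (fun x : E3 => x 1) ?_ (hc 1) (hc 1); intro x; simp [pow_two]; done)
      | (refine fin (fun x : E3 => x 2) (fun x : E3 => x 2) ?_ (hc 2) (hc 2); intro x; simp [pow_two]; done)
  simp only [hq, MvPolynomial.eval_eq']
  have e1 : ∀ d ∈ P.support, P.coeff d * ∏ i, (∑ a, l a • v a : E3) i ^ d i =
      ∑ a, l a * (P.coeff d * ∏ i, v a i ^ d i) + ∑ k, ∑ m, l k * l m *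
        (2 * (P.coeff d * ∏ i, ((1/2 : ℝ) • (v k + v m)) i ^ d i) - P.coeff d * ∏ i, v k i ^ d i
          - P.coeff d * ∏ i, v m i ^ d i) := by
    intro d hd
    obtain ⟨f, g, h1, h2, h3, h4, h5⟩ := key d hd
    simp only [h1, h2, h3, h4, h5]
    rw [quad_prod _ _ _ hl, mul_add, Finset.mul_sum, Finset.mul_sum]
    congr 1
    · exact Finset.sum_congr rfl fun _ _ => by ring
    · refine Finset.sum_congr rfl fun _ _ => ?_
      rw [Finset.mul_sum]
      exact Finset.sum_congr rfl fun _ _ => by ring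
  rw [Finset.sum_congr rfl e1, Finset.sum_add_distrib]
  congr 1
  · rw [Finset.sum_comm]
    simp [Finset.mul_sum]
  · rw [Finset.sum_comm]
    refine Finset.sum_congr rfl fun _ _ => ?_
    rw [Finset.sum_comm]
    refine Finset.sum_congr rfl fun _ _ => ?_
    rw [Finset.mul_sum, ← Finset.sum_sub_distrib, ← Finset.sum_sub_distrib, Finset.mul_sum]

def Tri : Set (ℝ × ℝ) := {z | 0 ≤ z.1 ∧ 0 ≤ z.2 ∧ z.1 + z.2 ≤ 1}

lemma tri_meas : MeasurableSet Tri := by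
  have : IsClosed Tri := by
    refine IsClosed.and (isClosed_le continuous_const continuous_fst)
      (IsClosed.and (isClosed_le continuous_const continuous_snd) (isClosed_le (by fun_prop) continuous_const))
  exact this.measurableSet

lemma tri_int (f : ℝ × ℝ → ℝ) (hf : Continuous f) :
    ∫ z in Tri, f z = ∫ s in (0:ℝ)..1, ∫ t in (0:ℝ)..(1 - s), f (s, t) := by
  have hsub : Tri ⊆ Set.Icc (0:ℝ) 1 ×ˢ Set.Icc (0:ℝ) 1 := by
    rintro ⟨s, t⟩ ⟨h1, h2, h3⟩
    simp only at h1 h2 h3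
    exact ⟨⟨h1, by simp only; linarith⟩, ⟨h2, by simp only; linarith⟩⟩
  have hint : IntegrableOn f Tri := 
    (hf.continuousOn.integrableOn_compact (isCompact_Icc.prod isCompact_Icc)).mono_set hsub
  have hi2 : Integrable (Tri.indicator f) := (integrable_indicator_iff tri_meas).2 hint
  rw [← integral_indicator tri_meas]
  rw [Measure.volume_eq_prod, integral_prod _ hi2]
  rw [intervalIntegral.integral_of_le zero_le_one, ← integral_Icc_eq_integral_Ioc,
    ← integral_indicator measurableSet_Icc]
  congr 1
  ext s
  by_cases hs : s ∈ Set.Icc (0:ℝ) 1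
  · rw [Set.indicator_of_mem hs, intervalIntegral.integral_of_le (by linarith [hs.2]),
      ← integral_Icc_eq_integral_Ioc, ← integral_indicator measurableSet_Icc]
    congr 1
    ext t
    by_cases ht : t ∈ Set.Icc (0:ℝ) (1-s)
    · rw [Set.indicator_of_mem ht, Set.indicator_of_mem]
      exact ⟨hs.1, ht.1, by simp only; linarith [ht.2]⟩
    · rw [Set.indicator_of_notMem ht, Set.indicator_of_notMem]
      rintro ⟨h1, h2, h3⟩
      exact ht ⟨h2, by simp only at h3; linarith⟩
  · rw [Set.indicator_of_notMem hs]
    have : ∀ t, Tri.indicator f (s, t) = 0 := by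
      intro t
      apply Set.indicator_of_notMem
      intro h
      exact hs (hsub h).1
    simp [this]

lemma tri_cubic (c0 c1 c2 c3 c4 c5 c6 c7 c8 c9 : ℝ) :
    ∫ z in Tri, (c0 + c1 * z.1 + c2 * z.2 + c3 * z.1^2 + c4 * (z.1 * z.2) + c5 * z.2^2
      + c6 * z.1^3 + c7 * (z.1^2 * z.2) + c8 * (z.1 * z.2^2) + c9 * z.2^3) =
    c0/2 + c1/6 + c2/6 + c3/12 + c4/24 + c5/12 + c6/20 + c7/60 + c8/60 + c9/20 := by
  rw [tri_int _ (by fun_prop)]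
  have inner : ∀ s : ℝ, ∫ t in (0:ℝ)..(1 - s), (c0 + c1 * s + c2 * t + c3 * s^2 + c4 * (s * t) + c5 * t^2
      + c6 * s^3 + c7 * (s^2 * t) + c8 * (s * t^2) + c9 * t^3) =
      (c0 + c1 * s + c3 * s^2 + c6 * s^3) * (1-s) + (c2 + c4 * s + c7 * s^2) * (1-s)^2/2
        + (c5 + c8 * s) * (1-s)^3/3 + c9 * (1-s)^4/4 := by
    intro s
    have := intervalIntegral.integral_eq_sub_of_hasDerivAt (a := 0) (b := 1 - s)
      (f := fun t => (c0 + c1 * s + c3 * s^2 + c6 * s^3) * t + (c2 + c4 * s + c7 * s^2) * t^2/2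
        + (c5 + c8 * s) * t^3/3 + c9 * t^4/4)
      (f' := fun t => c0 + c1 * s + c2 * t + c3 * s^2 + c4 * (s * t) + c5 * t^2
      + c6 * s^3 + c7 * (s^2 * t) + c8 * (s * t^2) + c9 * t^3) ?_ ?_
    · rw [this]; ring
    · intro t _
      have h1 := (hasDerivAt_id t).const_mul (c0 + c1 * s + c3 * s^2 + c6 * s^3)
      have h2 := ((hasDerivAt_pow 2 t).const_mul (c2 + c4 * s + c7 * s^2)).div_const 2
      have h3 := ((hasDerivAt_pow 3 t).const_mul (c5 + c8 * s)).div_const 3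
      have h4 := ((hasDerivAt_pow 4 t).const_mul c9).div_const 4
      refine (((h1.add h2).add h3).add h4).congr_deriv ?_
      norm_num; ring
    · exact Continuous.intervalIntegrable (by fun_prop) _ _
  simp only [inner]
  let F : ℝ → ℝ := fun s => c0 * (s - s^2/2) + c1 * (s^2/2 - s^3/3) + c3 * (s^3/3-s^4/4) + c6 * (s^4/4-s^5/5)
    + c2/2 * (s - s^2 + s^3/3) + c4/2 * (s^2/2 - 2*s^3/3 + s^4/4) + c7/2*(s^3/3-2*s^4/4+s^5/5)
    + c5/3 * (s - 3*s^2/2 + s^3 - s^4/4) + c8/3*(s^2/2 - s^3 + 3*s^4/4 - s^5/5)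
    + c9/4 * (s - 2*s^2 + 2*s^3 - s^4 + s^5/5)
  rw [intervalIntegral.integral_eq_sub_of_hasDerivAt (f := F)]
  · simp only [F]; ring
  · intro s _
    have hp : ∀ n : ℕ, HasDerivAt (fun s : ℝ => s^n) (n * s^(n-1)) s := fun n => hasDerivAt_pow n s
    have hd : DifferentiableAt ℝ F s := by simp only [F]; fun_prop
    refine hd.hasDerivAt.congr_deriv ?_
    simp only [F]
    have h1 := hasDerivAt_id s
    have h2 := hp 2
    have h3 := hp 3
    have h4 := hp 4
    have h5 := hp 5
    have big := ((((((((((h1.sub (h2.div_const 2)).const_mul c0).add (((h2.div_const 2).sub (h3.div_const 3)).const_mul c1)).add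
      (((h3.div_const 3).sub (h4.div_const 4)).const_mul c3)).add (((h4.div_const 4).sub (h5.div_const 5)).const_mul c6)).add
      (((h1.sub h2).add (h3.div_const 3)).const_mul (c2/2))).add
      ((((h2.div_const 2).sub ((h3.const_mul 2).div_const 3)).add (h4.div_const 4)).const_mul (c4/2))).add
      ((((h3.div_const 3).sub ((h4.const_mul 2).div_const 4)).add (h5.div_const 5)).const_mul (c7/2))).add
      ((((h1.sub ((h2.const_mul 3).div_const 2)).add h3).sub (h4.div_const 4)).const_mul (c5/3))).add
      (((((h2.div_const 2).sub h3).add ((h4.const_mul 3).div_const 4)).sub (h5.div_const 5)).const_mul (c8/3))).add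
      (((((h1.sub (h2.const_mul 2)).add (h3.const_mul 2)).sub h4).add (h5.div_const 5)).const_mul (c9/4))
    refine (HasDerivAt.deriv big).trans ?_
    norm_num; ring
  · exact Continuous.intervalIntegrable (by fun_prop) _ _

lemma face_param (p u w : E3) (hu : LinearIndependent ℝ ![u, w]) (S : Set E3) (hS : MeasurableSet S)
    (hSr : ∀ x ∈ S, ∃ z : ℝ × ℝ, x = p + (z.1 • u + z.2 • w))
    (hT : ∀ z : ℝ × ℝ, p + (z.1 • u + z.2 • w) ∈ S ↔ z ∈ Tri) :
    ∃ C : ℝ, C ≠ 0 ∧ ∀ F : E3 → ℝ, ∫ x in S, F x ∂μH[2] = C * ∫ z in Tri, F (p + (z.1 • u + z.2 • w)) := by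
  let V : Submodule ℝ E3 := Submodule.span ℝ (Set.range ![u, w])
  have hfr : Module.finrank ℝ V = 2 := by
    have := finrank_span_eq_card hu
    simpa using this
  let B : Module.Basis (Fin 2) ℝ V := Module.Basis.span hu
  let e0 : (ℝ × ℝ) ≃ₗ[ℝ] V := (LinearEquiv.finTwoArrow ℝ ℝ).symm.trans B.equivFun.symm
  let e : (ℝ × ℝ) ≃L[ℝ] V := e0.toContinuousLinearEquiv
  have he : ∀ z : ℝ × ℝ, (e z : E3) = z.1 • u + z.2 • w := by
    intro z
    have : e z = B.equivFun.symm ![z.1, z.2] := rfl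
    rw [this, Module.Basis.equivFun_symm_apply, Fin.sum_univ_two]
    have b0 : (B 0 : E3) = u := congrArg Subtype.val (Module.Basis.span_apply hu 0)
    have b1 : (B 1 : E3) = w := congrArg Subtype.val (Module.Basis.span_apply hu 1)
    simp [b0, b1]
  have hH : Measure.IsAddHaarMeasure (μH[2] : Measure V) := by
    have := MeasureTheory.isAddHaarMeasure_hausdorffMeasure (E := V)
    rw [hfr] at this
    exact_mod_cast this
  have hM : Measure.IsAddHaarMeasure (Measure.map e (volume : Measure (ℝ × ℝ))) :=
    ContinuousLinearEquiv.isAddHaarMeasure_map e _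
  let c := Measure.addHaarScalarFactor (μH[2] : Measure V) (Measure.map e (volume : Measure (ℝ × ℝ)))
  have hc : (μH[2] : Measure V) = c • Measure.map e (volume : Measure (ℝ × ℝ)) :=
    Measure.isAddLeftInvariant_eq_smul _ _
  have hcpos : 0 < c := Measure.addHaarScalarFactor_pos_of_isAddHaarMeasure _ _
  let ψ : V → E3 := fun y => p + y
  have hψ : Isometry ψ := (isometry_add_left p).comp V.subtypeₗᵢ.isometry
  have hψm : MeasurableEmbedding ψ := hψ.isClosedEmbedding.measurableEmbedding
  have hem : MeasurableEmbedding e := e.toHomeomorph.measurableEmbedding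
  refine ⟨c, by exact_mod_cast hcpos.ne', fun F => ?_⟩
  have hr : S ⊆ Set.range ψ := by
    intro x hx
    obtain ⟨z, hz⟩ := hSr x hx
    exact ⟨e z, by simp only [ψ, he]; exact hz.symm⟩
  have h1 : (μH[2] : Measure E3).restrict S = (Measure.map ψ μH[2]).restrict S := by
    rw [hψ.map_hausdorffMeasure (Or.inl (by norm_num)), Measure.restrict_restrict_of_subset hr]
  rw [h1, hψm.setIntegral_map, hc, Measure.restrict_smul, integral_smul_nnreal_measure, hem.setIntegral_map]
  have h2 : e ⁻¹' (ψ ⁻¹' S) = Tri := by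
    ext z
    rw [← hT z]
    simp only [Set.mem_preimage, ψ, he]
  rw [h2]
  simp only [ψ, he]
  rfl

lemma sum4 (f : Fin 4 → ℝ) (i j k l : Fin 4) (hij : i ≠ j) (hik : i ≠ k) (hil : i ≠ l)
    (hjk : j ≠ k) (hjl : j ≠ l) (hkl : k ≠ l) : ∑ a, f a = f i + f j + f k + f l := by
  have : (Finset.univ : Finset (Fin 4)) = {i, j, k, l} := by
    revert i j k l; decide
  rw [this, Finset.sum_insert, Finset.sum_insert, Finset.sum_insert, Finset.sum_singleton]
  · ring
  all_goals simp [*]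

lemma exists_two (i j : Fin 4) (hij : i ≠ j) : ∃ k l : Fin 4, i ≠ k ∧ i ≠ l ∧ j ≠ k ∧ j ≠ l ∧ k ≠ l ∧
    ∀ a, a = i ∨ a = j ∨ a = k ∨ a = l := by
  revert i j; decide

def bf (g h : Fin 3 → ℝ) : Matrix (Fin 3) (Fin 3) ℝ →ₗ[ℝ] ℝ where
  toFun M := ∑ r, ∑ s, g r * M r s * h s
  map_add' M N := by
    simp only [Matrix.add_apply, mul_add, add_mul, Finset.sum_add_distrib]
  map_smul' c M := by
    simp only [Matrix.smul_apply, smul_eq_mul, RingHom.id_apply, Finset.mul_sum]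
    exact Finset.sum_congr rfl fun _ _ => Finset.sum_congr rfl fun _ _ => by ring

lemma bf_apply (g h : Fin 3 → ℝ) (M : Matrix (Fin 3) (Fin 3) ℝ) :
    bf g h M = ∑ r, ∑ s, g r * M r s * h s := rfl

lemma bf_symm (g h : Fin 3 → ℝ) (M : Matrix (Fin 3) (Fin 3) ℝ) (hM : M.IsSymm) :
    bf g h M = bf h g M := by
  rw [bf_apply, bf_apply, Finset.sum_comm]
  refine Finset.sum_congr rfl fun r _ => Finset.sum_congr rfl fun s _ => ?_
  rw [hM.apply r s]; ring

structure Geo (v : Fin 4 → E3) (lam : Fin 4 → (E3 →ᵃ[ℝ] ℝ)) (G : Fin 4 → Fin 3 → ℝ) : Prop where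
  lam_v : ∀ a c, lam a (v c) = if a = c then 1 else 0
  sum_one : ∀ x, ∑ a, lam a x = 1
  recon : ∀ x, ∑ a, lam a x • v a = x
  lin : ∀ a x y, lam a x - lam a y = ∑ r, G a r * (x r - y r)
  gdef : ∀ a m, (lam a).linear (EuclideanSpace.single m 1) = G a m

lemma exists_geo (v : Fin 4 → E3) (hv : AffineIndependent ℝ v) : ∃ lam G, Geo v lam G := by
  have htop : affineSpan ℝ (Set.range v) = ⊤ := by
    rw [hv.affineSpan_eq_top_iff_card_eq_finrank_add_one]; simp
  let b : AffineBasis (Fin 4) ℝ E3 := ⟨v, hv, htop⟩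
  have hb : ∀ a, b a = v a := fun _ => rfl
  refine ⟨fun a => b.coord a, fun a m => (b.coord a).linear (EuclideanSpace.single m 1), ?_, ?_, ?_, ?_, ?_⟩
  · intro a c
    rw [← hb c, b.coord_apply]
  · intro x; exact b.sum_coord_apply_eq_one x
  · intro x; exact b.linear_combination_coord_eq_self x
  · intro a x y
    have h1 : (b.coord a) x - (b.coord a) y = (b.coord a).linear (x - y) := by
      have := (b.coord a).linearMap_vsub x y
      simpa using this.symm
    have h2 : x - y = ∑ r, (x r - y r) • (EuclideanSpace.single r (1:ℝ) : E3) := by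
      ext s
      simp [Finset.sum_apply, Pi.single_apply]
    rw [h1, h2, map_sum]
    refine Finset.sum_congr rfl fun r _ => ?_
    rw [map_smul, smul_eq_mul, mul_comm]
  · intro a m; rfl

namespace Geo
variable {v : Fin 4 → E3} {lam : Fin 4 → (E3 →ᵃ[ℝ] ℝ)} {G : Fin 4 → Fin 3 → ℝ}

lemma dot (h : Geo v lam G) (a c d : Fin 4) :
    ∑ r, G a r * (v c r - v d r) = (if a = c then 1 else 0) - (if a = d then 1 else 0) := by
  rw [← h.lin, h.lam_v, h.lam_v]

lemma sumG (h : Geo v lam G) (r : Fin 3) : ∑ a, G a r = 0 := by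
  have : ∀ a, G a r = lam a (EuclideanSpace.single r 1) - lam a 0 := by
    intro a
    rw [h.lin]
    simp [Pi.single_apply]
  simp only [this, Finset.sum_sub_distrib, h.sum_one, sub_self]

lemma dual (h : Geo v lam G) (r s : Fin 3) : ∑ a, G a r * v a s = if r = s then 1 else 0 := by
  have : ∀ a, G a r = lam a (EuclideanSpace.single r 1) - lam a 0 := by
    intro a
    rw [h.lin]
    simp [Pi.single_apply]
  have h1 := congrArg (fun x : E3 => x s) (h.recon (EuclideanSpace.single r 1))
  have h2 := congrArg (fun x : E3 => x s) (h.recon 0)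
  simp [Pi.single_apply] at h1 h2
  simp only [this, sub_mul, Finset.sum_sub_distrib, h1, h2, sub_zero, eq_comm]

lemma bf_eq_zero (h : Geo v lam G) (M : Matrix (Fin 3) (Fin 3) ℝ)
    (hM : ∀ i j, bf (G i) (G j) M = 0) : M = 0 := by
  ext r s
  have e : M r s = ∑ i, ∑ j, v i r * v j s * bf (G i) (G j) M := by
    calc M r s = ∑ p, ∑ q, (if p = r then 1 else 0) * M p q * (if q = s then 1 else 0) := by
          simp
      _ = ∑ p, ∑ q, (∑ a, G a p * v a r) * M p q * (∑ a, G a q * v a s) := by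
          simp only [h.dual]
      _ = _ := by
          simp only [bf_apply, Fin.sum_univ_three, Fin.sum_univ_four]; ring
  rw [e]; simp [hM]

lemma bf_sum_right (h : Geo v lam G) (g : Fin 3 → ℝ) (M : Matrix (Fin 3) (Fin 3) ℝ) :
    ∑ j, bf g (G j) M = 0 := by
  have h0 := h.sumG 0
  have h1 := h.sumG 1
  have h2 := h.sumG 2
  simp only [bf_apply, Fin.sum_univ_three, Fin.sum_univ_four] at *
  linear_combination (g 0 * M 0 0 + g 1 * M 1 0 + g 2 * M 2 0) * h0 + (g 0 * M 0 1 + g 1 * M 1 1 + g 2 * M 2 1) * h1 + (g 0 * M 0 2 + g 1 * M 1 2 + g 2 * M 2 2) * h2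

lemma face_moment (h : Geo v lam G) (i j k l : Fin 4) (hij : i ≠ j) (hik : i ≠ k) (hil : i ≠ l)
    (hjk : j ≠ k) (hjl : j ≠ l) (hkl : k ≠ l) (F : E3 → ℝ) (aj ak al bjk bjl bkl : ℝ)
    (hF : ∀ x, lam i x = 0 → F x = aj * lam j x + ak * lam k x + al * lam l x +
      2 * (bjk * (lam j x * lam k x) + bjl * (lam j x * lam l x) + bkl * (lam k x * lam l x)))
    (hint : ∫ x in Face v i, F x * lam j x ∂μH[2] = 0) :
    10 * aj + 5 * ak + 5 * al + 4 * bjk + 4 * bjl + 2 * bkl = 0 := by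
  have lamz : ∀ a (z : ℝ × ℝ), lam a (v j + (z.1 • (v k - v j) + z.2 • (v l - v j))) =
      lam a (v j) + z.1 * (lam a (v k) - lam a (v j)) + z.2 * (lam a (v l) - lam a (v j)) := by
    intro a z
    have e1 := h.lin a (v j + (z.1 • (v k - v j) + z.2 • (v l - v j))) (v j)
    have e2 := h.lin a (v k) (v j)
    have e3 := h.lin a (v l) (v j)
    simp [Fin.sum_univ_three] at e1 e2 e3
    linear_combination e1 - z.1 * e2 - z.2 * e3
  have li : ∀ z : ℝ × ℝ, lam i (v j + (z.1 • (v k - v j) + z.2 • (v l - v j))) = 0 := by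
    intro z; rw [lamz]; simp [h.lam_v, *]
  have lj : ∀ z : ℝ × ℝ, lam j (v j + (z.1 • (v k - v j) + z.2 • (v l - v j))) = 1 - z.1 - z.2 := by
    intro z; rw [lamz]; simp [h.lam_v, *]; ring
  have lk : ∀ z : ℝ × ℝ, lam k (v j + (z.1 • (v k - v j) + z.2 • (v l - v j))) = z.1 := by
    intro z; rw [lamz]; simp [h.lam_v, *, hjk.symm]
  have ll : ∀ z : ℝ × ℝ, lam l (v j + (z.1 • (v k - v j) + z.2 • (v l - v j))) = z.2 := by
    intro z; rw [lamz]; simp [h.lam_v, *, hjl.symm, hkl.symm]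
  have hlinind : LinearIndependent ℝ ![v k - v j, v l - v j] := by
    rw [LinearIndependent.pair_iff]
    intro s t hst
    have e1 := lk (s, t)
    have e2 := ll (s, t)
    simp only [hst, add_zero, h.lam_v] at e1 e2
    simp [hjk.symm, hjl.symm] at e1 e2
    exact ⟨e1.symm, e2.symm⟩
  have hface : ∀ x ∈ Face v i, lam i x = 0 ∧ ∀ a, 0 ≤ lam a x := by
    have hconv : Convex ℝ {x : E3 | lam i x = 0 ∧ ∀ a, 0 ≤ lam a x} := by
      intro x hx y hy s t hs ht hst
      have : ∀ a, lam a (s • x + t • y) = s * lam a x + t * lam a y := by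
        intro a
        have := Convex.combo_affine_apply (f := lam a) (x := x) (y := y) hst
        simpa using this
      refine ⟨?_, fun a => ?_⟩
      · rw [this, hx.1, hy.1]; simp
      · rw [this]
        exact add_nonneg (mul_nonneg hs (hx.2 a)) (mul_nonneg ht (hy.2 a))
    have : Face v i ⊆ {x : E3 | lam i x = 0 ∧ ∀ a, 0 ≤ lam a x} := by
      refine convexHull_min ?_ hconv
      rintro _ ⟨c, hc, rfl⟩
      refine ⟨?_, fun a => ?_⟩
      · rw [h.lam_v, if_neg (Ne.symm hc)]
      · rw [h.lam_v]; split_ifs <;> norm_num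
    exact fun x hx => this hx
  have hmeas : MeasurableSet (Face v i) := by
    have : (v '' {j | j ≠ i}).Finite := Set.toFinite _
    exact (this.isCompact_convexHull (𝕜 := ℝ)).isClosed.measurableSet
  obtain ⟨C, hC, hCF⟩ := face_param (v j) (v k - v j) (v l - v j) hlinind (Face v i) hmeas
    (by
      intro x hx
      refine ⟨(lam k x, lam l x), ?_⟩
      have h0 := (hface x hx).1
      have hs := h.sum_one x
      have hr := h.recon x
      rw [sum4 _ i j k l hij hik hil hjk hjl hkl, h0] at hs
      ext r
      have hr' := congrArg (fun x : E3 => x r) hr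
      simp only [PiLp.add_apply, PiLp.smul_apply, PiLp.sub_apply, smul_eq_mul, WithLp.ofLp_sum, Finset.sum_apply] at hr' ⊢
      rw [sum4 _ i j k l hij hik hil hjk hjl hkl, h0] at hr'
      linear_combination -hr' + v j r * hs)
    (by
      intro z
      constructor
      · intro hz
        have := (hface _ hz).2
        have h1 := this j
        have h2 := this k
        have h3 := this l
        rw [lj] at h1
        rw [lk] at h2
        rw [ll] at h3
        exact ⟨h2, h3, by linarith⟩
      · rintro ⟨h1, h2, h3⟩
        have hvj : v j ∈ Face v i := subset_convexHull ℝ _ ⟨j, hij.symm, rfl⟩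
        have hvk : v k ∈ Face v i := subset_convexHull ℝ _ ⟨k, hik.symm, rfl⟩
        have hvl : v l ∈ Face v i := subset_convexHull ℝ _ ⟨l, hil.symm, rfl⟩
        have hc : Convex ℝ (Face v i) := convex_convexHull ℝ _
        have := hc.sum_mem (t := Finset.univ) (w := ![1 - z.1 - z.2, z.1, z.2]) (z := ![v j, v k, v l])
          (by intro a _; fin_cases a <;> simp <;> linarith)
          (by simp [Fin.sum_univ_three]; ring) (by intro a _; fin_cases a <;> simpa)
        convert this using 1
        simp [Fin.sum_univ_three]
        module)
  rw [hCF] at hint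
  have hint2 := (mul_eq_zero.1 hint).resolve_left hC
  have e : ∀ z : ℝ × ℝ, F (v j + (z.1 • (v k - v j) + z.2 • (v l - v j))) *
      lam j (v j + (z.1 • (v k - v j) + z.2 • (v l - v j))) = 
      (aj + (-2*aj + ak + 2*bjk) * z.1 + (-2*aj+al+2*bjl) * z.2 + (aj - ak - 4*bjk) * z.1^2
       + (2*aj-ak-al-4*bjk-4*bjl+2*bkl) * (z.1 * z.2) + (aj - al - 4*bjl) * z.2^2
      + (2*bjk) * z.1^3 + (4*bjk+2*bjl-2*bkl) * (z.1^2 * z.2) + (2*bjk+4*bjl-2*bkl) * (z.1 * z.2^2) + (2*bjl) * z.2^3) := by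
    intro z
    rw [hF _ (li z), lj, lk, ll]; ring
  simp only [e] at hint2
  rw [tri_cubic] at hint2
  linarith

end Geo

lemma alg_core (A : Fin 4 → Fin 4 → Fin 4 → ℝ) (B : Fin 4 → Fin 4 → Fin 4 → Fin 4 → ℝ)
    (hAs : ∀ a i j, A a i j = A a j i) (hBs : ∀ k l i j, B k l i j = B k l j i)
    (hBk : ∀ k l i j, B k l i j = B l k i j)
    (hA0 : ∀ a i, ∑ j, A a i j = 0) (hB0 : ∀ k l i, ∑ j, B k l i j = 0)
    (hedge : ∀ k l m n, k ≠ l → m ≠ k → m ≠ l → n ≠ k → n ≠ l → B k l m n = 0)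
    (hface : ∀ i j k l p, i ≠ j → i ≠ k → i ≠ l → j ≠ k → j ≠ l → k ≠ l →
      10 * A j i p + 5 * A k i p + 5 * A l i p + 4 * B j k i p + 4 * B j l i p + 2 * B k l i p = 0) :
    (∀ a i j, A a i j = 0) ∧ ∀ k l i j, k ≠ l → B k l i j = -(B k l k l) *
      (((if i = l then 1 else 0) - (if i = k then 1 else 0)) *
        ((if j = l then 1 else 0) - (if j = k then 1 else 0))) := by
  have c1 : ∀ i j k l, i ≠ j → i ≠ k → i ≠ l → j ≠ k → j ≠ l → k ≠ l → B j k i j = B i k i j := by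
    intro i j k l hij hik hil hjk hjl hkl
    have e1 := hface i j k l j hij hik hil hjk hjl hkl
    have e2 := hface i k j l j hik hij hil hjk.symm hkl hjl
    have e3 := hface i l j k j hil hij hik hjl.symm hkl.symm hjk
    have e4 := hface j i k l i hij.symm hjk hjl hik hil hkl
    have e5 := hface j k i l i hjk hij.symm hjl hik.symm hkl hil
    have e6 := hface j l i k i hjl hij.symm hjk hil.symm hkl.symm hik
    have e7 := hedge k l i j hkl hik hil hjk hjl
    rw [hBk k j] at e2
    rw [hBk l j, hBk l k] at e3
    rw [hAs _ j i, hAs _ j i, hAs _ j i, hBs _ _ j i, hBs _ _ j i, hBs _ _ j i] at e4 e5 e6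
    rw [hBk k i] at e5
    rw [hBk l i, hBk l k] at e6
    linarith
  have c2 : ∀ i j k l, i ≠ j → i ≠ k → i ≠ l → j ≠ k → j ≠ l → k ≠ l → B j k i j = - B j k i k := by
    intro i j k l hij hik hil hjk hjl hkl
    have e := hB0 j k i
    rw [sum4 _ i j k l hij hik hil hjk hjl hkl] at e
    have e1 := hedge j k i i hjk hij hik hij hik
    have e2 := hedge j k i l hjk hij hik hjl.symm hkl.symm
    linarith
  have c3 : ∀ i j k l, i ≠ j → i ≠ k → i ≠ l → j ≠ k → j ≠ l → k ≠ l → B j k i j = 0 := by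
    intro i j k l hij hik hil hjk hjl hkl
    have s1 := c2 i j k l hij hik hil hjk hjl hkl
    have s2 := c1 i k j l hik hij hil hjk.symm hkl hjl
    have s3 := c2 k i j l hik.symm hjk.symm hkl hij hil hjl
    have s4 := c1 j k i l hjk hij.symm hjl hik.symm hkl hil
    have s5 := c2 j k i l hjk hij.symm hjl hik.symm hkl hil
    have s6 := c1 i j k l hij hik hil hjk hjl hkl
    rw [hBk k j] at s2
    rw [hBs _ _ k i, hBs _ _ k j] at s3
    rw [hBk k i, hBk j i] at s4
    rw [hBk k i j k, hBk k i j i, hBs _ _ j i] at s5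
    linarith
  have c4 : ∀ i j k l, i ≠ j → i ≠ k → i ≠ l → j ≠ k → j ≠ l → k ≠ l →
      A j i j = 0 ∧ A k i j = 0 := by
    intro i j k l hij hik hil hjk hjl hkl
    have e1 := hface i j k l j hij hik hil hjk hjl hkl
    have e2 := hface i k j l j hik hij hil hjk.symm hkl hjl
    have e3 := hface i l j k j hil hij hik hjl.symm hkl.symm hjk
    rw [hBk k j] at e2
    rw [hBk l j, hBk l k] at e3
    have e7 := hedge k l i j hkl hik hil hjk hjl
    have f1 := c3 i j k l hij hik hil hjk hjl hkl
    have f2 := c3 i j l k hij hil hik hjl hjk hkl.symm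
    constructor <;> linarith
  have c5 : ∀ a i j, i ≠ j → A a i j = 0 := by
    intro a i j hij
    obtain ⟨k, l, hik, hil, hjk, hjl, hkl, hall⟩ := exists_two i j hij
    have f1 := c4 i j k l hij hik hil hjk hjl hkl
    have f2 := c4 i j l k hij hil hik hjl hjk hkl.symm
    have f3 := c4 j i k l hij.symm hjk hjl hik hil hkl
    rcases hall a with rfl | rfl | rfl | rfl
    · rw [hAs]; exact f3.1
    · exact f1.1
    · exact f1.2
    · exact f2.2
  refine ⟨?_, ?_⟩
  · intro a i j
    by_cases hij : i = j
    · subst hij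
      have h0 := hA0 a i
      rw [Finset.sum_eq_single i (fun b _ hb => c5 a i b hb.symm) (by simp)] at h0
      exact h0
    · exact c5 a i j hij
  · intro k l i j hkl
    obtain ⟨m, n, hkm, hkn, hlm, hln, hmn, hall⟩ := exists_two k l hkl
    have z1 : ∀ p q, p ≠ q → k ≠ p → k ≠ q → l ≠ p → l ≠ q → 
        B k l p k = 0 ∧ B k l p l = 0 ∧ B k l p p = 0 ∧ B k l p q = 0 := by
      intro p q hpq hkp hkq hlp hlq
      refine ⟨?_, ?_, ?_, ?_⟩
      · exact c3 p k l q hkp.symm hlp.symm hpq hkl hkq hlq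
      · rw [hBk]; exact c3 p l k q hlp.symm hkp.symm hpq hkl.symm hlq hkq
      · exact hedge k l p p hkl hkp.symm hlp.symm hkp.symm hlp.symm
      · exact hedge k l p q hkl hkp.symm hlp.symm hkq.symm hlq.symm
    obtain ⟨m1, m2, m3, m4⟩ := z1 m n hmn hkm hkn hlm hln
    obtain ⟨n1, n2, n3, n4⟩ := z1 n m hmn.symm hkn hkm hln hlm
    have k0 := hB0 k l k
    have l0 := hB0 k l l
    rw [sum4 _ k l m n hkl hkm hkn hlm hln hmn] at k0 l0
    have km : B k l k m = 0 := by rw [hBs]; exact m1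
    have kn : B k l k n = 0 := by rw [hBs]; exact n1
    have lm : B k l l m = 0 := by rw [hBs]; exact m2
    have ln : B k l l n = 0 := by rw [hBs]; exact n2
    have hlk : B k l l k = B k l k l := hBs _ _ _ _
    have kk : B k l k k = - B k l k l := by linarith
    have lle : B k l l l = - B k l k l := by linarith
    rcases hall i with hi | hi | hi | hi <;> rcases hall j with hj | hj | hj | hj <;>
      rw [hi, hj] <;> simp [*, hkl.symm, hkm.symm, hkn.symm, hlm.symm, hln.symm]

lemma rigid_core (D : Fin 4 → Fin 4 → ℝ) (hD : ∀ a b, D a b = D b a) (V W : Fin 4 → Fin 3 → ℝ)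
    (hW : ∀ a r, W a r = ∑ l, D a l * (V l r - V a r))
    (hr : ∀ a b, ∑ r, (W a r - W b r) * (V a r - V b r) = 0) : ∀ a r, W a r = 0 := by
  have key : ∑ a, ∑ r, W a r * W a r = 0 := by
    have h1 : ∑ a, ∑ b, D a b * ∑ r, (W a r - W b r) * (V a r - V b r) = 0 := by
      simp [hr]
    have h2 : ∑ a, ∑ b, D a b * ∑ r, (W a r - W b r) * (V a r - V b r) =
        -2 * ∑ a, ∑ r, W a r * W a r := by
      have e : ∀ a r, W a r * W a r = W a r * ∑ l, D a l * (V l r - V a r) := by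
        intro a r; rw [← hW]
      simp only [e]
      have hs : ∑ a, ∑ b, D a b * ∑ r, (W a r - W b r) * (V a r - V b r) =
          ∑ a, ∑ b, D a b * ∑ r, W a r * (V a r - V b r) + ∑ a, ∑ b, D a b * ∑ r, W b r * (V b r - V a r) := by
        rw [← Finset.sum_add_distrib]
        refine Finset.sum_congr rfl fun a _ => ?_
        rw [← Finset.sum_add_distrib]
        refine Finset.sum_congr rfl fun b _ => ?_
        rw [← mul_add, ← Finset.sum_add_distrib]
        congr 1
        exact Finset.sum_congr rfl fun r _ => by ring
      have hs2 : ∑ a, ∑ b, D a b * ∑ r, W b r * (V b r - V a r) =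
          ∑ a, ∑ b, D a b * ∑ r, W a r * (V a r - V b r) := by
        rw [Finset.sum_comm]
        refine Finset.sum_congr rfl fun a _ => Finset.sum_congr rfl fun b _ => ?_
        rw [hD]
      rw [hs, hs2, ← two_mul, neg_mul, ← mul_neg, ← Finset.sum_neg_distrib]
      congr 1
      refine Finset.sum_congr rfl fun a _ => ?_
      simp only [Fin.sum_univ_three, Fin.sum_univ_four]
      ring
    linarith
  intro a r
  have h1 := (Finset.sum_eq_zero_iff_of_nonneg (fun a _ => Finset.sum_nonneg fun r _ => mul_self_nonneg (W a r))).1 key a (Finset.mem_univ a)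
  have h2 := (Finset.sum_eq_zero_iff_of_nonneg (fun r _ => mul_self_nonneg (W a r))).1 h1 r (Finset.mem_univ r)
  exact mul_self_eq_zero.1 h2

namespace Geo
variable {v : Fin 4 → E3} {lam : Fin 4 → (E3 →ᵃ[ℝ] ℝ)} {G : Fin 4 → Fin 3 → ℝ}

lemma hasFDerivAt (h : Geo v lam G) (a : Fin 4) (x : E3) :
    ∃ L : E3 →L[ℝ] ℝ, HasFDerivAt (fun y => lam a y) L x ∧ ∀ m, L (EuclideanSpace.single m 1) = G a m := by
  refine ⟨LinearMap.toContinuousLinearMap (lam a).linear, ?_, fun m => h.gdef a m⟩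
  have e : (fun y => lam a y) = fun y => (LinearMap.toContinuousLinearMap (lam a).linear) y + lam a 0 := by
    ext y
    have := (lam a).decomp
    have h2 := congrFun this y
    simpa using h2
  rw [e]
  exact (ContinuousLinearMap.hasFDerivAt _).add_const _

lemma div_formula (h : Geo v lam G) (τ : E3 → Matrix (Fin 3) (Fin 3) ℝ)
    (B : Fin 4 → Fin 4 → Matrix (Fin 3) (Fin 3) ℝ) (hB : ∀ k l, B k l = B l k)
    (hτ : ∀ x, τ x = ∑ k, ∑ l, (lam k x * lam l x) • B k l) (r : Fin 3) (a : Fin 4) :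
    divRow τ r (v a) = 2 * ∑ l, ∑ m, B a l r m * G l m := by
  choose L hL hLG using fun c => h.hasFDerivAt c (v a)
  have hd : ∀ m, fderiv ℝ (fun y => τ y r m) (v a) (EuclideanSpace.single m 1) =
      2 * ∑ l, B a l r m * G l m := by
    intro m
    have e : (fun y => τ y r m) = fun y => ∑ k, ∑ l, (lam k y * lam l y) * B k l r m := by
      ext y
      rw [hτ]
      simp [Matrix.sum_apply]
    have H : HasFDerivAt (fun y => ∑ k, ∑ l, (lam k y * lam l y) * B k l r m)
        (∑ k, ∑ l, B k l r m • (lam k (v a) • L l + lam l (v a) • L k)) (v a) := by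
      refine HasFDerivAt.fun_sum fun k _ => HasFDerivAt.fun_sum fun l _ => ?_
      exact ((hL k).mul (hL l)).mul_const _
    rw [e, H.fderiv]
    simp only [ContinuousLinearMap.sum_apply, ContinuousLinearMap.smul_apply, ContinuousLinearMap.add_apply, hLG, h.lam_v, smul_eq_mul]
    simp only [mul_add, Finset.sum_add_distrib]
    simp only [ite_mul, one_mul, zero_mul, mul_ite, mul_zero, Finset.sum_ite_eq', Finset.mem_univ, if_true]
    have e2 : ∑ k, ∑ l, (if k = a then B k l r m * G l m else 0) = ∑ l, B a l r m * G l m := by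
      rw [Finset.sum_comm]; simp
    rw [e2, two_mul]
    congr 1
    exact Finset.sum_congr rfl fun l _ => by rw [hB]
  unfold divRow
  simp only [hd]
  rw [← Finset.mul_sum, Finset.sum_comm]

lemma exists_normal (h : Geo v lam G) (i : Fin 4) :
    ∃ c : ℝ, c ≠ 0 ∧ IsOutwardNormal v i (WithLp.toLp 2 (fun r => c * G i r)) := by
  obtain ⟨j, hj⟩ : ∃ j, i ≠ j := by revert i; decide
  let g : E3 := WithLp.toLp 2 (G i)
  have hg : g ≠ 0 := by
    intro h0
    have h1 := h.dot i i j
    have : ∀ r, G i r = 0 := fun r => congrArg (fun x : E3 => x r) h0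
    simp [this, hj] at h1
  have hn : 0 < ‖g‖ := norm_pos_iff.2 hg
  have e : (WithLp.toLp 2 (fun r => -(‖g‖)⁻¹ * G i r) : E3) = (-(‖g‖)⁻¹) • g := by
    ext r; simp [g]
  have hin : ∀ a b, ⟪v a - v b, g⟫ = (if i = a then 1 else 0) - (if i = b then 1 else 0) := by
    intro a b
    rw [← h.dot, PiLp.inner_apply]
    refine Finset.sum_congr rfl fun r _ => ?_
    simp [g]
  refine ⟨-(‖g‖)⁻¹, by simp [hg], ?_⟩
  rw [e]
  refine ⟨?_, ?_, ?_⟩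
  · rw [norm_smul]; simp; field_simp
  · intro a b ha hb
    rw [inner_smul_right, hin]; simp [ha.symm, hb.symm]
  · intro a ha
    rw [inner_smul_right, hin]; simp [ha.symm, hn]

end Geo

lemma Geo.edge_zero {v : Fin 4 → E3} {lam : Fin 4 → (E3 →ᵃ[ℝ] ℝ)} {G : Fin 4 → Fin 3 → ℝ}
    (h : Geo v lam G) (τ : E3 → Matrix (Fin 3) (Fin 3) ℝ)
    (hτ : ∀ k l : Fin 4, k ≠ l → ∀ s : E3, ‖s‖ = 1 → (∃ c : ℝ, v l - v k = c • s) →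
      ∀ i j : Fin 3, AffineOn (Edge v k l) (fun x => (Qmat s * τ x * Qmat s) i j))
    (k l m n : Fin 4) (hkl : k ≠ l) (hmk : m ≠ k) (hml : m ≠ l) (hnk : n ≠ k) (hnl : n ≠ l) :
    bf (G m) (G n) ((2:ℝ) • τ ((1/2:ℝ) • (v k + v l)) - τ (v k) - τ (v l)) = 0 := by
  have hne : v l - v k ≠ 0 := by
    intro h0
    have h1 := h.dot k k l
    have : ∀ r, v k r - v l r = 0 := fun r => by
      have := congrArg (fun x : E3 => x r) h0
      simp at this
      linarith
    simp [this, hkl] at h1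
  let t := v l - v k
  have ht : ‖t‖ ≠ 0 := norm_ne_zero_iff.2 hne
  let s : E3 := (‖t‖)⁻¹ • t
  have hs : ‖s‖ = 1 := by simp only [s]; rw [norm_smul]; simp; field_simp
  have hts : v l - v k = ‖t‖ • s := by simp only [s]; rw [smul_smul, mul_inv_cancel₀ ht, one_smul]
  have hG : ∀ p : Fin 4, p ≠ k → p ≠ l → ∑ r, G p r * s r = 0 := by
    intro p hpk hpl
    have h1 := h.dot p l k
    simp only [if_neg hpk, if_neg hpl, sub_zero] at h1
    have : ∀ r, s r = (‖t‖)⁻¹ * (v l r - v k r) := fun r => by simp [s, t]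
    simp only [this]
    rw [Fin.sum_univ_three] at *
    linear_combination (‖t‖)⁻¹ * h1
  have hQ : ∀ M, bf (G m) (G n) (Qmat s * M * Qmat s) = bf (G m) (G n) M := by
    intro M
    have hm := hG m hmk hml
    have hn := hG n hnk hnl
    have q1 : Matrix.vecMul (G m) (Qmat s) = G m := by
      ext r
      simp only [Qmat, Matrix.vecMul_sub, Matrix.vecMul_one, Pi.sub_apply]
      have : (G m ᵥ* Matrix.vecMulVec (fun i => s i) (fun i => s i)) r = (∑ q, G m q * s q) * s r := by
        simp [Matrix.vecMul, dotProduct, Matrix.vecMulVec_apply, Finset.sum_mul, mul_assoc]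
      rw [this, hm]; simp
    have q2 : Matrix.mulVec (Qmat s) (G n) = G n := by
      ext r
      simp only [Qmat, Matrix.sub_mulVec, Matrix.one_mulVec, Pi.sub_apply]
      have : (Matrix.vecMulVec (fun i => s i) (fun i => s i) *ᵥ G n) r = s r * (∑ q, G n q * s q) := by
        simp only [Matrix.mulVec, dotProduct, Matrix.vecMulVec_apply, Finset.mul_sum]
        exact Finset.sum_congr rfl fun _ _ => by ring
      rw [this, hn]; simp
    have q3 : ∀ N, bf (G m) (G n) N = G m ⬝ᵥ (N *ᵥ G n) := by
      intro N
      simp [bf_apply, dotProduct, Matrix.mulVec, Finset.mul_sum, mul_assoc]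
    rw [q3, q3, ← Matrix.mulVec_mulVec, q2, ← Matrix.mulVec_mulVec, Matrix.dotProduct_mulVec, q1]
  have hmat : Qmat s * ((2:ℝ) • τ ((1/2:ℝ) • (v k + v l)) - τ (v k) - τ (v l)) * Qmat s = 0 := by
    ext i j
    obtain ⟨q, hq⟩ := hτ k l hkl s hs ⟨_, hts⟩ i j
    have m1 : v k ∈ Edge v k l := left_mem_segment ℝ _ _
    have m2 : v l ∈ Edge v k l := right_mem_segment ℝ _ _
    have m3 : (1/2:ℝ) • (v k + v l) ∈ Edge v k l :=
      ⟨1/2, 1/2, by norm_num, by norm_num, by norm_num, by rw [smul_add]⟩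
    have e1 := hq _ m1
    have e2 := hq _ m2
    have e3 := hq _ m3
    have e4 : q ((1/2:ℝ) • (v k + v l)) = 1/2 * q (v k) + 1/2 * q (v l) := by
      have := Convex.combo_affine_apply (f := q) (x := v k) (y := v l) (a := 1/2) (b := 1/2) (by norm_num)
      rw [smul_add, this]; simp
    simp only [Matrix.mul_sub, Matrix.sub_mul, Matrix.sub_apply, Matrix.mul_smul, Matrix.smul_mul, Matrix.smul_apply, smul_eq_mul]
    simp only at e1 e2 e3
    rw [e1, e2, e3, e4]; simp; ring
  rw [← hQ, hmat, map_zero]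

/-- Unisolvence for the reduced element: if `τ ∈ Σ̃_K`, i.e. `τ ∈ Σ_K` with
`div τ ∈ 𝕋(K)` (row-wise divergence a rigid motion), and all the face degrees of
freedom `∫_f τ n_f · v ds`, `v ∈ P₁(f;ℝ³)`, vanish, then `τ = 0` on `K`. -/
theorem stmt_11 (v : Fin 4 → E3) (hv : AffineIndependent ℝ v)
    (τ : E3 → Matrix (Fin 3) (Fin 3) ℝ) (hτ : MemSigmaK v τ)
    (hdiv : IsRigidOn (Tet v) (fun x r => divRow τ r x))
    (hface : ∀ i : Fin 4, ∀ n : E3, IsOutwardNormal v i n →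
      ∀ w : Fin 3 → (E3 →ᵃ[ℝ] ℝ),
        ∫ x in Face v i, ((τ x).mulVec (fun r => n r)) ⬝ᵥ (fun r => w r x) ∂μH[2] = 0) :
    ∀ x ∈ Tet v, τ x = 0 := by
  obtain ⟨lam, G, h⟩ := exists_geo v hv
  obtain ⟨hpoly, hsym, hedge⟩ := hτ
  let B : Fin 4 → Fin 4 → Matrix (Fin 3) (Fin 3) ℝ := fun k l =>
    (2:ℝ) • τ ((1/2:ℝ) • (v k + v l)) - τ (v k) - τ (v l)
  have hBdef : ∀ k l, B k l = (2:ℝ) • τ ((1/2:ℝ) • (v k + v l)) - τ (v k) - τ (v l) := fun _ _ => rfl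
  have hBk : ∀ k l, B k l = B l k := by
    intro k l
    rw [hBdef, hBdef, add_comm (v k)]; abel
  have hBkk : ∀ k, B k k = 0 := by
    intro k
    have : (1/2:ℝ) • (v k + v k) = v k := by module
    rw [hBdef, this]; module
  have hform : ∀ x, τ x = ∑ a, lam a x • τ (v a) + ∑ k, ∑ l, (lam k x * lam l x) • B k l := by
    intro x
    ext r s
    have := quad_formula (fun x => τ x r s) (hpoly r s) v (fun a => lam a x) (h.sum_one x)
    simp only [h.recon] at this
    rw [this]
    simp [Matrix.sum_apply, hBdef]
  have hTv : ∀ a, v a ∈ Tet v := fun a => subset_convexHull ℝ _ ⟨a, rfl⟩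
  have hTm : ∀ k l, (1/2:ℝ) • (v k + v l) ∈ Tet v := by
    intro k l
    rw [smul_add]
    exact (convex_convexHull ℝ _) (hTv k) (hTv l) (by norm_num) (by norm_num) (by norm_num)
  have hBsym : ∀ k l, (B k l).IsSymm := by
    intro k l
    rw [hBdef]
    exact (((hsym _ (hTm k l)).smul _).sub (hsym _ (hTv k))).sub (hsym _ (hTv l))
  have core := alg_core (fun a i j => bf (G i) (G j) (τ (v a))) (fun k l i j => bf (G i) (G j) (B k l))
    (fun a i j => bf_symm _ _ _ (hsym _ (hTv a))) (fun k l i j => bf_symm _ _ _ (hBsym k l))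
    (fun k l i j => by simp only [hBk k l]) (fun a i => h.bf_sum_right _ _) (fun k l i => h.bf_sum_right _ _)
    (fun k l m n hkl h1 h2 h3 h4 => h.edge_zero τ hedge k l m n hkl h1 h2 h3 h4)
    (by
      intro i j k l p hij hik hil hjk hjl hkl
      refine h.face_moment i j k l hij hik hil hjk hjl hkl (fun x => bf (G i) (G p) (τ x)) _ _ _ _ _ _ ?_ ?_
      · intro x hx
        rw [hform x, map_add, map_sum, map_sum]
        simp only [map_sum, map_smul, smul_eq_mul]
        simp only [sum4 _ i j k l hij hik hil hjk hjl hkl, hx, hBkk, map_zero]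
        rw [hBk k j, hBk l j, hBk l k]
        ring
      · obtain ⟨c, hc, hn⟩ := h.exists_normal i
        have H := hface i _ hn (fun r => G p r • lam j)
        have e : ∀ x ∈ Face v i, ((τ x).mulVec (fun r => (WithLp.toLp 2 (fun r => c * G i r) : E3) r)) ⬝ᵥ
            (fun r => (G p r • lam j) x) = c * (bf (G i) (G p) (τ x) * lam j x) := by
          intro x hx
          have hxT : x ∈ Tet v := convexHull_mono (Set.image_subset_range _ _) hx
          rw [bf_symm _ _ _ (hsym x hxT)]
          simp [bf_apply, dotProduct, Matrix.mulVec, Fin.sum_univ_three]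
          ring
        have hmeas : MeasurableSet (Face v i) := by
          have : (v '' {j | j ≠ i}).Finite := Set.toFinite _
          exact (this.isCompact_convexHull (𝕜 := ℝ)).isClosed.measurableSet
        rw [setIntegral_congr_fun hmeas e, integral_const_mul] at H
        exact (mul_eq_zero.1 H).resolve_left hc)
  obtain ⟨hA, hB⟩ := core
  have hT0 : ∀ a, τ (v a) = 0 := fun a => h.bf_eq_zero _ (hA a)
  let c : Fin 4 → Fin 4 → ℝ := fun k l => bf (G k) (G l) (B k l)
  have hcs : ∀ k l, c k l = c l k := by
    intro k l
    simp only [c]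
    rw [hBk k l, bf_symm _ _ _ (hBsym l k)]
  have hBc : ∀ k l, B k l = (-(c k l)) • Matrix.of (fun r s => (v l r - v k r) * (v l s - v k s)) := by
    intro k l
    by_cases hkl : k = l
    · subst hkl
      rw [hBkk]; ext; simp
    · rw [← sub_eq_zero]
      refine h.bf_eq_zero _ fun i j => ?_
      have e : bf (G i) (G j) (Matrix.of (fun r s => (v l r - v k r) * (v l s - v k s))) =
          ((if i = l then 1 else 0) - (if i = k then 1 else 0)) *
            ((if j = l then 1 else 0) - (if j = k then 1 else 0)) := by
        rw [← h.dot i l k, ← h.dot j l k]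
        simp [bf_apply, Fin.sum_univ_three]
        ring
      rw [map_sub, map_smul, e, hB k l i j hkl, smul_eq_mul, sub_self]
  have hform2 : ∀ x, τ x = ∑ k, ∑ l, (lam k x * lam l x) • B k l := by
    intro x
    rw [hform x]; simp [hT0]
  have hdivf : ∀ a r, divRow τ r (v a) = ∑ l, (-2 * c a l) * (v l r - v a r) := by
    intro a r
    rw [h.div_formula τ B hBk hform2, Finset.mul_sum]
    refine Finset.sum_congr rfl fun l _ => ?_
    by_cases hal : l = a
    · subst hal
      simp [hBkk]
    · have h1 := h.dot l l a
      simp [hal, Fin.sum_univ_three] at h1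
      rw [hBc]
      simp only [Matrix.smul_apply, Matrix.of_apply, smul_eq_mul, Fin.sum_univ_three]
      linear_combination (-2 * c a l * (v l r - v a r)) * h1
  obtain ⟨p, q, hrig⟩ := hdiv
  have hrig2 : ∀ a r, divRow τ r (v a) = p r + (crossProduct q (fun m => v a m)) r := by
    intro a r
    exact congrFun (hrig (v a) (hTv a)) r
  have hW := rigid_core (fun a l => -2 * c a l) (fun a b => by simp only [hcs a b]) (fun a r => v a r)
    (fun a r => divRow τ r (v a)) hdivf (by
      intro a b
      simp only [hrig2, Fin.sum_univ_three, cross_apply]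
      simp
      ring)
  have hc0 : ∀ a b, a ≠ b → c a b = 0 := by
    intro a b hab
    have e0 : ∀ r, ∑ l, (-2 * c a l) * (v l r - v a r) = 0 := fun r => by
      rw [← hdivf]; exact hW a r
    have e1 : ∑ r, G b r * ∑ l, (-2 * c a l) * (v l r - v a r) = 0 := by
      simp only [e0, mul_zero, Finset.sum_const_zero]
    have e2 : ∑ r, G b r * ∑ l, (-2 * c a l) * (v l r - v a r) =
        ∑ l, (-2 * c a l) * ∑ r, G b r * (v l r - v a r) := by
      simp only [Finset.mul_sum]
      rw [Finset.sum_comm]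
      exact Finset.sum_congr rfl fun _ _ => Finset.sum_congr rfl fun _ _ => by ring
    rw [e2] at e1
    simp only [h.dot] at e1
    simpa [hab.symm] using e1
  have hB00 : ∀ k l, B k l = 0 := by
    intro k l
    by_cases hkl : k = l
    · subst hkl; exact hBkk k
    · rw [hBc, hc0 k l hkl]; simp
  intro x _
  rw [hform2 x]
  simp [hB00]
end
end

section
/- Let K be a nondegenerate tetrahedron in ℝ³ and let τ ∈ P₂(K; 𝕊) be a quadratic symmetric-matrix-valued polynomial field whose row-wise divergence div τ is a rigid motion, i.e., div τ ∈ 𝕋(K). If ∫_{∂K} τ n · v ds = 0 for every rigid motion v ∈ 𝕋(K) (where n is the outward unit normal of K), then div τ = 0 identically on K. -/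
open MeasureTheory RealInnerProductSpace Matrix

noncomputable section

/-- The standard solid simplex. -/
def SX (n : ℕ) : Set (Fin n → ℝ) := {y | (∀ i, 0 ≤ y i) ∧ ∑ i, y i ≤ 1}

def ins (k : Fin 3) (t : ℝ) (w : Fin 2 → ℝ) : Fin 3 → ℝ := Fin.insertNth (α := fun _ => ℝ) k t w

lemma ins_same (k : Fin 3) (t : ℝ) (w : Fin 2 → ℝ) : ins k t w k = t := by simp [ins]
lemma ins_above (k : Fin 3) (t : ℝ) (w : Fin 2 → ℝ) (j : Fin 2) : ins k t w (k.succAbove j) = w j := by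
  simp [ins]

lemma isClosed_SX (n : ℕ) : IsClosed (SX n) := by
  have : SX n = (⋂ i, {y | 0 ≤ y i}) ∩ {y | ∑ i, y i ≤ 1} := by
    ext y; simp [SX]
  rw [this]
  exact (isClosed_iInter fun i => isClosed_le continuous_const (continuous_apply i)).inter
    (isClosed_le (by fun_prop) continuous_const)

lemma isCompact_SX (n : ℕ) : IsCompact (SX n) := by
  apply (isCompact_Icc (a := (0 : Fin n → ℝ)) (b := 1)).of_isClosed_subset (isClosed_SX n)
  rintro y ⟨h0, h1⟩
  refine ⟨fun i => h0 i, fun i => ?_⟩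
  exact (Finset.single_le_sum (f := y) (fun j _ => h0 j) (Finset.mem_univ i)).trans h1

lemma convex_SX (n : ℕ) : Convex ℝ (SX n) := by
  rintro x ⟨hx0, hx1⟩ y ⟨hy0, hy1⟩ a b ha hb hab
  refine ⟨fun i => ?_, ?_⟩
  · have := mul_nonneg ha (hx0 i)
    have := mul_nonneg hb (hy0 i)
    simp; linarith
  · simp only [Pi.add_apply, Pi.smul_apply, smul_eq_mul, Finset.sum_add_distrib, ← Finset.mul_sum]
    nlinarith

lemma SX3_subset : SX 3 ⊆ closure (interior (SX 3)) := by
  have hne : (interior (SX 3)).Nonempty := by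
    refine ⟨fun _ => 1/4, ?_⟩
    rw [mem_interior]
    refine ⟨(⋂ i, {y | 0 < y i}) ∩ {y | ∑ i, y i < 1}, ?_, ?_, ?_⟩
    · rintro y ⟨h0, h1⟩
      simp only [Set.mem_iInter, Set.mem_ofPred_eq] at h0 h1
      exact ⟨fun i => (h0 i).le, h1.le⟩
    · exact (isOpen_iInter_of_finite fun i => isOpen_lt continuous_const (continuous_apply i)).inter
        (isOpen_lt (by fun_prop) continuous_const)
    · simp; norm_num
  rw [(convex_SX 3).closure_interior_eq_closure_of_nonempty_interior hne]
  exact subset_closure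

lemma hasDerivAt_ins (k : Fin 3) (w : Fin 2 → ℝ) (t : ℝ) :
    HasDerivAt (fun t => ins k t w) (Pi.single k (1:ℝ)) t := by
  rw [hasDerivAt_pi]
  intro i
  rcases Fin.eq_self_or_eq_succAbove k i with rfl | ⟨j, rfl⟩
  · simp only [ins_same, Pi.single_eq_same]; exact hasDerivAt_id t
  · simp only [ins_above, Pi.single_eq_of_ne (Fin.succAbove_ne k j)]; exact hasDerivAt_const t (w j)

lemma mem_ins (k : Fin 3) (t : ℝ) (w : Fin 2 → ℝ) :
    ins k t w ∈ SX 3 ↔ (w ∈ SX 2 ∧ t ∈ Set.Icc 0 (1 - ∑ j, w j)) := by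
  simp only [SX, Set.mem_ofPred_eq, Fin.forall_iff_succAbove k, Fin.sum_univ_succAbove _ k,
    ins_same, ins_above, Set.mem_Icc]
  constructor
  · rintro ⟨⟨h1, h2⟩, h3⟩
    exact ⟨⟨h2, by linarith⟩, h1, by linarith⟩
  · rintro ⟨⟨h1, h2⟩, h3, h4⟩
    exact ⟨⟨h3, h1⟩, by linarith⟩

lemma stokes (g : (Fin 3 → ℝ) → ℝ) (hg : ContDiff ℝ 1 g) (k : Fin 3) :
    ∫ y in SX 3, fderiv ℝ g y (Pi.single k 1) =
      ∫ w in SX 2, (g (ins k (1 - ∑ j, w j) w) - g (ins k 0 w)) := by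
  set h : (Fin 3 → ℝ) → ℝ := fun y => fderiv ℝ g y (Pi.single k 1) with hh
  have hc : Continuous h := (hg.continuous_fderiv one_ne_zero).clm_apply continuous_const
  have hm3 := (isClosed_SX 3).measurableSet
  have hm2 := (isClosed_SX 2).measurableSet
  have hi : Integrable ((SX 3).indicator h) := by
    rw [integrable_indicator_iff hm3]
    exact hc.continuousOn.integrableOn_compact (isCompact_SX 3)
  have mp := (volume_preserving_piFinSuccAbove (fun _ : Fin 3 => ℝ) k).symm
  have e1 : ∫ y in SX 3, h y = ∫ p : ℝ × (Fin 2 → ℝ), (SX 3).indicator h (ins k p.1 p.2) := by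
    rw [← integral_indicator hm3]
    exact (mp.integral_comp' _).symm
  have hi2 : Integrable (fun p : ℝ × (Fin 2 → ℝ) => (SX 3).indicator h (ins k p.1 p.2)) := 
    (mp.integrable_comp_emb (MeasurableEquiv.measurableEmbedding _)).2 hi
  rw [e1, Measure.volume_eq_prod, integral_prod_symm _ hi2, ← integral_indicator hm2]
  congr 1
  ext w
  by_cases hw : w ∈ SX 2
  · rw [Set.indicator_of_mem hw]
    have hle : 0 ≤ 1 - ∑ j, w j := by have := hw.2; linarith
    have : (fun t => (SX 3).indicator h (ins k t w)) =
        (Set.Icc 0 (1 - ∑ j, w j)).indicator (fun t => h (ins k t w)) := by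
      ext t
      by_cases ht : t ∈ Set.Icc 0 (1 - ∑ j, w j)
      · rw [Set.indicator_of_mem ht, Set.indicator_of_mem ((mem_ins k t w).2 ⟨hw, ht⟩)]
      · rw [Set.indicator_of_notMem ht,
          Set.indicator_of_notMem (fun h' => ht ((mem_ins k t w).1 h').2)]
    simp only [this]
    rw [integral_indicator measurableSet_Icc, integral_Icc_eq_integral_Ioc,
      ← intervalIntegral.integral_of_le hle]
    rw [intervalIntegral.integral_eq_sub_of_hasDerivAt (f := fun t => g (ins k t w))]
    · intro t _
      exact ((hg.differentiable one_ne_zero _).hasFDerivAt).comp_hasDerivAt t (hasDerivAt_ins k w t)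
    · apply Continuous.intervalIntegrable
      exact hc.comp (continuous_iff_continuousAt.2 fun t => (hasDerivAt_ins k w t).continuousAt)
  · rw [Set.indicator_of_notMem hw]
    simp [mem_ins, hw]

lemma hull_param {n : ℕ} (u : Fin (n+1) → E3) (p : Fin (n+1)) :
    convexHull ℝ (Set.range u) =
      (fun y : Fin n → ℝ => u p + ∑ j, y j • (u (p.succAbove j) - u p)) '' SX n := by
  apply Set.Subset.antisymm
  · apply convexHull_min
    · rintro _ ⟨i, rfl⟩
      rcases Fin.eq_self_or_eq_succAbove p i with rfl | ⟨j, rfl⟩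
      · exact ⟨0, ⟨by simp, by simp⟩, by simp⟩
      · refine ⟨Pi.single j 1, ⟨fun i => ?_, by simp⟩, ?_⟩
        · by_cases hij : i = j
          · subst hij; simp
          · simp [hij]
        · simp [Pi.single_apply]
    · rintro _ ⟨x, hx, rfl⟩ _ ⟨y, hy, rfl⟩ a b ha hb hab
      refine ⟨a • x + b • y, convex_SX n hx hy ha hb hab, ?_⟩
      simp only [Pi.add_apply, Pi.smul_apply, smul_eq_mul, add_smul, Finset.sum_add_distrib, smul_add,
        mul_smul, Finset.smul_sum]
      obtain rfl : a = 1 - b := by linarith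
      module
  · rintro _ ⟨y, ⟨h0, h1⟩, rfl⟩
    have : u p + ∑ j, y j • (u (p.succAbove j) - u p) =
        ∑ i, (Fin.insertNth (α := fun _ => ℝ) p (1 - ∑ j, y j) y i : ℝ) • u i := by
      rw [Fin.sum_univ_succAbove _ p]
      simp only [Fin.insertNth_apply_same, Fin.insertNth_apply_succAbove, smul_sub,
        Finset.sum_sub_distrib, sub_smul, Finset.sum_smul, one_smul]
      abel
    simp only [this]
    apply (convex_convexHull ℝ _).sum_mem
    · intro i _
      rcases Fin.eq_self_or_eq_succAbove p i with rfl | ⟨j, rfl⟩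
      · simpa using h1
      · simpa using h0 j
    · rw [Fin.sum_univ_succAbove _ p]; simp
    · intro i _
      exact subset_convexHull ℝ _ ⟨i, rfl⟩

lemma face_eq (v : Fin 4 → E3) (i : Fin 4) : 
    Face v i = convexHull ℝ (Set.range (v ∘ i.succAbove)) := by
  unfold Face
  rw [Set.range_comp, Fin.range_succAbove]
  rfl

abbrev E2 := EuclideanSpace ℝ (Fin 2)

lemma exists_c : ∃ c : ℝ, 0 < c ∧ (μH[2] : Measure E2) = ENNReal.ofReal c • volume := by
  have hH : Measure.IsAddHaarMeasure (μH[2] : Measure E2) := by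
    simpa using MeasureTheory.isAddHaarMeasure_hausdorffMeasure (E := E2)
  refine ⟨Measure.addHaarScalarFactor (μH[2] : Measure E2) volume, ?_, ?_⟩
  · exact_mod_cast Measure.addHaarScalarFactor_pos_of_isAddHaarMeasure _ _
  · have := Measure.isAddLeftInvariant_eq_smul (μH[2] : Measure E2) volume
    rw [ENNReal.ofReal_coe_nnreal]
    exact this

lemma area_li (w : Fin 2 → E3) 
    (hgram : ⟪w 0, w 0⟫ * ⟪w 1, w 1⟫ - ⟪w 0, w 1⟫ ^ 2 ≠ 0) : LinearIndependent ℝ w := by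
  rw [Fintype.linearIndependent_iff]
  intro g hg
  rw [Fin.sum_univ_two] at hg
  have h0 : g 0 * ⟪w 0, w 0⟫ + g 1 * ⟪w 0, w 1⟫ = 0 := by
    have := congrArg (fun z => ⟪w 0, z⟫) hg
    simpa [inner_add_right, inner_smul_right] using this
  have h1 : g 0 * ⟪w 0, w 1⟫ + g 1 * ⟪w 1, w 1⟫ = 0 := by
    have := congrArg (fun z => ⟪w 1, z⟫) hg
    simpa [inner_add_right, inner_smul_right, real_inner_comm] using this
  have a0 : g 0 = 0 := by
    apply (mul_eq_zero.1 (?_ : g 0 * (⟪w 0, w 0⟫ * ⟪w 1, w 1⟫ - ⟪w 0, w 1⟫ ^ 2) = 0)).resolve_right hgram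
    linear_combination ⟪w 1, w 1⟫ * h0 - ⟪w 0, w 1⟫ * h1
  have a1 : g 1 = 0 := by
    apply (mul_eq_zero.1 (?_ : g 1 * (⟪w 0, w 0⟫ * ⟪w 1, w 1⟫ - ⟪w 0, w 1⟫ ^ 2) = 0)).resolve_right hgram
    linear_combination ⟪w 0, w 0⟫ * h1 - ⟪w 0, w 1⟫ * h0
  intro i; fin_cases i <;> assumption

lemma area_lemma {c : ℝ} (hc : 0 < c) (hH : (μH[2] : Measure E2) = ENNReal.ofReal c • volume)
    (p : E3) (w : Fin 2 → E3) (S : Set (Fin 2 → ℝ)) (hS : MeasurableSet S) (A : ℝ) (hA : 0 < A)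
    (hgram : ⟪w 0, w 0⟫ * ⟪w 1, w 1⟫ - ⟪w 0, w 1⟫ ^ 2 = A ^ 2) (f : E3 → ℝ) :
    ∫ x in (fun y : Fin 2 → ℝ => p + ∑ j, y j • w j) '' S, f x ∂μH[2] =
      c * A * ∫ y in S, f (p + ∑ j, y j • w j) := by
  have hli : LinearIndependent ℝ w := area_li w (by rw [hgram]; positivity)
  let V := Submodule.span ℝ (Set.range w)
  have hfr : Module.finrank ℝ V = 2 := by
    simpa using finrank_span_eq_card hli
  let e : V ≃ₗᵢ[ℝ] E2 := ((stdOrthonormalBasis ℝ V).reindex (finCongr hfr)).repr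
  let R : E2 →ₗᵢ[ℝ] E3 := V.subtypeₗᵢ.comp e.symm.toLinearIsometry
  let w' : Fin 2 → E2 := fun j => e ⟨w j, Submodule.subset_span ⟨j, rfl⟩⟩
  have hR : ∀ j, R (w' j) = w j := by
    intro j; simp [R, w']
  let M : Matrix (Fin 2) (Fin 2) ℝ := Matrix.of fun i j => w' j i
  have hdet : |M.det| = A := by
    have h1 : M.det ^ 2 = A ^ 2 := by
      rw [← hgram, ← hR 0, ← hR 1]
      simp only [LinearIsometry.inner_map_map]
      simp only [M, Matrix.det_fin_two, Matrix.of_apply, PiLp.inner_apply, Fin.sum_univ_two,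
        RCLike.inner_apply, conj_trivial]
      ring
    rw [← abs_of_pos hA]
    exact (sq_eq_sq_iff_abs_eq_abs _ _).1 h1
  let L : (Fin 2 → ℝ) →L[ℝ] (Fin 2 → ℝ) := LinearMap.toContinuousLinearMap (Matrix.toLin' M)
  have hLdet : |L.det| = A := by
    rw [← hdet]; congr 1
    show LinearMap.det (Matrix.toLin' M) = _
    exact LinearMap.det_toLin' M
  have hLinj : Function.Injective L := by
    have : IsUnit M.det := by
      rw [isUnit_iff_ne_zero]; intro h; rw [h] at hdet; simp at hdet; linarith
    have := (Matrix.mulVec_injective_iff_isUnit (A := M)).2 ((Matrix.isUnit_iff_isUnit_det _).2 this)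
    exact this
  let ψ : E2 → E3 := fun z => p + R z
  have hψ : Isometry ψ := (IsometryEquiv.addLeft p).isometry.comp R.isometry
  have hψe : MeasurableEmbedding ψ := hψ.isClosedEmbedding.measurableEmbedding
  have key : ∀ y : Fin 2 → ℝ, p + ∑ j, y j • w j = ψ (WithLp.toLp 2 (L y)) := by
    intro y
    have : WithLp.toLp 2 (L y) = ∑ j, y j • w' j := by
      ext i
      simp [L, M, Matrix.mulVec, dotProduct, Fin.sum_univ_two]
      ring
    simp only [ψ, this, map_sum, map_smul, hR]
  simp only [key]
  have him : (fun y : Fin 2 → ℝ => ψ (WithLp.toLp 2 (L y))) '' S = ψ '' (WithLp.toLp 2 '' (L '' S)) := by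
    simp only [Set.image_image]
  have hmap : (μH[2] : Measure E3).restrict (Set.range ψ) = Measure.map ψ μH[2] :=
    (hψ.map_hausdorffMeasure (Or.inl (by norm_num))).symm
  have hre : (μH[2] : Measure E3).restrict (ψ '' (WithLp.toLp 2 '' (L '' S))) =
      (Measure.map ψ μH[2]).restrict (ψ '' (WithLp.toLp 2 '' (L '' S))) := by
    rw [← hmap, Measure.restrict_restrict_of_subset (Set.image_subset_range _ _)]
  rw [him, hre, hψe.setIntegral_map, Set.preimage_image_eq _ hψe.injective, hH,
    Measure.restrict_smul, integral_smul_measure,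
    (PiLp.volume_preserving_toLp (Fin 2)).setIntegral_image_emb
      (MeasurableEquiv.toLp 2 (Fin 2 → ℝ)).measurableEmbedding,
    integral_image_eq_integral_abs_det_fderiv_smul volume hS
      (fun x _ => L.hasFDerivAt.hasFDerivWithinAt) hLinj.injOn, hLdet, integral_smul]
  simp [ENNReal.toReal_ofReal hc.le, mul_assoc]

lemma contDiff_of_isPolyLE {k : ℕ} {p : E3 → ℝ} (h : IsPolyLE k p) : ContDiff ℝ 1 p := by
  obtain ⟨P, -, hP⟩ := h
  have : p = fun x : E3 => MvPolynomial.eval (fun i => x i) P := funext hP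
  rw [this]
  clear hP this
  induction P using MvPolynomial.induction_on with
  | C a => simpa using contDiff_const
  | add p q hp hq => simpa using hp.add hq
  | mul_X p i hp => 
    simp only [map_mul, MvPolynomial.eval_X]
    exact hp.mul (by fun_prop)

def qf (a b : Fin 3 → ℝ) (x : E3) : Fin 3 → ℝ := a + crossProduct b (fun m => x m)

lemma qf_hasFDerivAt (a b : Fin 3 → ℝ) (r : Fin 3) : ∃ l : E3 →L[ℝ] ℝ,
    (∀ x, HasFDerivAt (fun x => qf a b x r) l x) ∧ ∀ z : E3, l z = crossProduct b (fun m => z m) r := by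
  let l : E3 →L[ℝ] ℝ := LinearMap.toContinuousLinearMap ((LinearMap.proj r).comp
    ((crossProduct b).comp (WithLp.linearEquiv 2 ℝ (Fin 3 → ℝ)).toLinearMap))
  have hl : ∀ z : E3, l z = crossProduct b (fun m => z m) r := fun z => rfl
  refine ⟨l, fun x => ?_, hl⟩
  have : (fun x => qf a b x r) = fun x => a r + l x := by
    ext x; simp only [qf, Pi.add_apply, hl]
  rw [this]
  exact l.hasFDerivAt.const_add _

lemma qf_contDiff (a b : Fin 3 → ℝ) (r : Fin 3) : ContDiff ℝ 1 (fun x => qf a b x r) := by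
  fin_cases r <;> simp only [qf, Pi.add_apply, cross_apply] <;> simp <;> fun_prop

def Ff (τ : E3 → Matrix (Fin 3) (Fin 3) ℝ) (a b : Fin 3 → ℝ) (j : Fin 3) (x : E3) : ℝ :=
  ∑ r, τ x r j * qf a b x r

lemma Ff_contDiff {τ : E3 → Matrix (Fin 3) (Fin 3) ℝ} (hτ : ∀ i j, ContDiff ℝ 1 (fun x => τ x i j))
    (a b : Fin 3 → ℝ) (j : Fin 3) : ContDiff ℝ 1 (Ff τ a b j) := by
  unfold Ff
  exact ContDiff.sum fun r _ => (hτ r j).mul (qf_contDiff a b r)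

lemma div_Ff {τ : E3 → Matrix (Fin 3) (Fin 3) ℝ} (hτ : ∀ i j, ContDiff ℝ 1 (fun x => τ x i j))
    (a b : Fin 3 → ℝ) (x : E3) (hs : (τ x).IsSymm) :
    ∑ j, fderiv ℝ (Ff τ a b j) x (EuclideanSpace.single j 1) = ∑ r, divRow τ r x * qf a b x r := by
  choose l hl hl2 using qf_hasFDerivAt a b
  have h1 : ∀ j, fderiv ℝ (Ff τ a b j) x (EuclideanSpace.single j 1) =
      ∑ r, (τ x r j * crossProduct b (fun m => (EuclideanSpace.single j (1:ℝ) : E3) m) r +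
        qf a b x r * fderiv ℝ (fun y => τ y r j) x (EuclideanSpace.single j 1)) := by
    intro j
    have : HasFDerivAt (Ff τ a b j) (∑ r, (τ x r j • l r + qf a b x r • fderiv ℝ (fun y => τ y r j) x)) x := by
      unfold Ff
      exact HasFDerivAt.fun_sum fun r _ =>
        (((hτ r j).differentiable one_ne_zero x).hasFDerivAt).mul (hl r x)
    rw [this.fderiv]
    simp [hl2]
  simp only [h1, divRow, Finset.sum_mul, Finset.sum_add_distrib]
  rw [Finset.sum_comm (f := fun j r => qf a b x r * fderiv ℝ (fun y => τ y r j) x (EuclideanSpace.single j 1))]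
  have h2 : ∑ j, ∑ r, τ x r j * crossProduct b (fun m => (EuclideanSpace.single j (1:ℝ) : E3) m) r = 0 := by
    have s01 := hs.apply 0 1
    have s02 := hs.apply 0 2
    have s12 := hs.apply 1 2
    simp [Fin.sum_univ_three, cross_apply, s01, s02, s12]
    ring
  rw [h2, zero_add]
  refine Finset.sum_congr rfl fun r _ => Finset.sum_congr rfl fun m _ => mul_comm _ _

def Bm (b : Fin 3 → E3) : Matrix (Fin 3) (Fin 3) ℝ := Matrix.of fun i j => b j i

lemma gram_k (b : Fin 3 → E3) (k : Fin 3) :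
    ⟪b (k.succAbove 0), b (k.succAbove 0)⟫ * ⟪b (k.succAbove 1), b (k.succAbove 1)⟫ -
      ⟪b (k.succAbove 0), b (k.succAbove 1)⟫ ^ 2 = ∑ j, ((Bm b).adjugate k j) ^ 2 := by
  simp only [PiLp.inner_apply, RCLike.inner_apply, conj_trivial, Fin.sum_univ_three, 
    Matrix.adjugate_fin_three, Bm, Matrix.of_apply]
  fin_cases k <;> simp [Fin.succAbove, Fin.lt_def] <;> ring

lemma gram_0 (b : Fin 3 → E3) (k : Fin 3) :
    ⟪b (k.succAbove 0) - b k, b (k.succAbove 0) - b k⟫ *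
      ⟪b (k.succAbove 1) - b k, b (k.succAbove 1) - b k⟫ -
      ⟪b (k.succAbove 0) - b k, b (k.succAbove 1) - b k⟫ ^ 2 =
        ∑ j, (∑ i, (Bm b).adjugate i j) ^ 2 := by
  simp only [PiLp.inner_apply, RCLike.inner_apply, conj_trivial, Fin.sum_univ_three, 
    Matrix.adjugate_fin_three, Bm, Matrix.of_apply]
  fin_cases k <;> simp [Fin.succAbove, Fin.lt_def] <;> ring

lemma adj_b (b : Fin 3 → E3) (k l : Fin 3) :
    ∑ m, (Bm b).adjugate k m * b l m = if k = l then (Bm b).det else 0 := by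
  have := congrFun (congrFun (Matrix.adjugate_mul (Bm b)) k) l
  rw [Matrix.mul_apply] at this
  simpa [Bm, Matrix.smul_apply, Matrix.one_apply] using this

lemma b_adj (b : Fin 3 → E3) (m j : Fin 3) :
    ∑ k, b k m * (Bm b).adjugate k j = if m = j then (Bm b).det else 0 := by
  have := congrFun (congrFun (Matrix.mul_adjugate (Bm b)) m) j
  rw [Matrix.mul_apply] at this
  simpa [Bm, Matrix.smul_apply, Matrix.one_apply] using this

lemma det_ne (v : Fin 4 → E3) (hv : AffineIndependent ℝ v) :
    (Bm (fun j => v j.succ - v 0)).det ≠ 0 := by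
  rw [affineIndependent_iff_linearIndependent_vsub ℝ v 0] at hv
  have h1 : LinearIndependent ℝ (fun j : Fin 3 => v j.succ - v 0) := by
    have := hv.comp (fun j : Fin 3 => (⟨j.succ, Fin.succ_ne_zero j⟩ : {x : Fin 4 // x ≠ 0}))
      (fun i j h => by simpa using h)
    exact this
  have h2 := h1.map' (WithLp.linearEquiv 2 ℝ (Fin 3 → ℝ)).toLinearMap (LinearEquiv.ker _)
  have h3 : IsUnit (Bm (fun j => v j.succ - v 0)) := by
    rw [← Matrix.linearIndependent_cols_iff_isUnit]
    exact h2
  exact ((Matrix.isUnit_iff_isUnit_det _).1 h3).ne_zero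

/-- unnormalised normals -/
def Nn (b : Fin 3 → E3) : Fin 4 → Fin 3 → ℝ :=
  Fin.cons (fun j => ∑ k, (Bm b).adjugate k j) (fun k j => - (Bm b).adjugate k j)

lemma Nn_dot (v : Fin 4 → E3) (i j : Fin 4) :
    ∑ m, (v j - v 0) m * Nn (fun j => v j.succ - v 0) i m =
     if i = 0 then (if j = 0 then 0 else (Bm (fun j => v j.succ - v 0)).det) else
      (if j = i then -(Bm (fun j => v j.succ - v 0)).det else 0) := by
  set b : Fin 3 → E3 := fun j => v j.succ - v 0 with hb
  refine Fin.cases ?_ (fun k => ?_) i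
  · refine Fin.cases (by simp) (fun l => ?_) j
    simp only [Nn, Fin.cons_zero, if_true, Fin.succ_ne_zero, if_false, Finset.mul_sum]
    rw [Finset.sum_comm]
    have : ∀ k, ∑ m, (v l.succ - v 0) m * (Bm b).adjugate k m = if k = l then (Bm b).det else 0 := by
      intro k
      rw [← adj_b b k l]
      exact Finset.sum_congr rfl fun m _ => mul_comm _ _
    simp only [this]
    simp
  · refine Fin.cases (by simp [(Fin.succ_ne_zero k).symm]) (fun l => ?_) j
    simp only [Nn, Fin.cons_succ, Fin.succ_ne_zero, if_false, Fin.succ_inj, mul_neg,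
      Finset.sum_neg_distrib]
    have : ∑ m, (v l.succ - v 0) m * (Bm b).adjugate k m = if k = l then (Bm b).det else 0 := by
      rw [← adj_b b k l]
      exact Finset.sum_congr rfl fun m _ => mul_comm _ _
    rw [this]
    simp only [eq_comm (a := k)]
    split_ifs <;> simp

lemma Nn_pos (v : Fin 4 → E3) (hv : AffineIndependent ℝ v) (i : Fin 4) :
    0 < ∑ m, Nn (fun j => v j.succ - v 0) i m ^ 2 := by
  have hd := det_ne v hv
  rcases (Finset.sum_nonneg fun m _ => sq_nonneg (Nn (fun j => v j.succ - v 0) i m)).lt_or_eq with h | h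
  · exact h
  · exfalso
    have h0 : ∀ m, Nn (fun j => v j.succ - v 0) i m = 0 := by
      intro m
      have := (Finset.sum_eq_zero_iff_of_nonneg (fun m _ => sq_nonneg _)).1 h.symm m (Finset.mem_univ m)
      exact pow_eq_zero_iff two_ne_zero |>.1 this
    have h1 := Nn_dot v i (if i = 0 then 1 else i)
    simp only [h0, mul_zero, Finset.sum_const_zero] at h1
    by_cases hi : i = 0
    · simp [hi] at h1; exact hd h1.symm
    · simp [hi] at h1; exact hd h1

def nor (v : Fin 4 → E3) (s : ℝ) (i : Fin 4) : E3 :=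
  WithLp.toLp 2 fun m => s / √(∑ m, Nn (fun j => v j.succ - v 0) i m ^ 2) *
    Nn (fun j => v j.succ - v 0) i m

lemma nor_outward (v : Fin 4 → E3) (hv : AffineIndependent ℝ v) (s : ℝ) (hs : s ^ 2 = 1)
    (hsd : 0 < s * (Bm (fun j => v j.succ - v 0)).det) (i : Fin 4) :
    IsOutwardNormal v i (nor v s i) := by
  have hp := Nn_pos v hv i
  have hr : 0 < √(∑ m, Nn (fun j => v j.succ - v 0) i m ^ 2) := Real.sqrt_pos.2 hp
  have hr2 := Real.sq_sqrt hp.le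
  have hdot : ∀ j l : Fin 4, ⟪v j - v l, nor v s i⟫ =
      s / √(∑ m, Nn (fun j => v j.succ - v 0) i m ^ 2) *
      (∑ m, (v j - v 0) m * Nn (fun j => v j.succ - v 0) i m -
       ∑ m, (v l - v 0) m * Nn (fun j => v j.succ - v 0) i m) := by
    intro j l
    rw [← Finset.sum_sub_distrib, Finset.mul_sum, PiLp.inner_apply]
    refine Finset.sum_congr rfl fun m _ => ?_
    simp only [RCLike.inner_apply, conj_trivial, nor, PiLp.sub_apply]
    ring
  refine ⟨?_, ?_, ?_⟩
  · rw [EuclideanSpace.norm_eq, Real.sqrt_eq_one]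
    simp only [nor, Real.norm_eq_abs, sq_abs, mul_pow, ← Finset.mul_sum]
    rw [div_pow, hr2, hs]
    field_simp
  · intro j k hj hk
    rw [hdot, Nn_dot, Nn_dot]
    by_cases hi : i = 0
    · subst hi; simp [hj, hk]
    · simp [hi, hj, hk]
  · intro j hj
    rw [hdot, Nn_dot, Nn_dot]
    have : 0 < s * (Bm (fun j => v j.succ - v 0)).det / √(∑ m, Nn (fun j => v j.succ - v 0) i m ^ 2) :=
      div_pos hsd hr
    by_cases hi : i = 0
    · subst hi; simp [hj]; 
      rw [div_mul_eq_mul_div]; exact this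
    · simp [hi, hj]
      rw [div_mul_eq_mul_div]; exact this
def Xf (v : Fin 4 → E3) (y : Fin 3 → ℝ) : E3 := v 0 + ∑ j : Fin 3, y j • (v j.succ - v 0)

lemma tet_eq (v : Fin 4 → E3) : Tet v = Xf v '' SX 3 := by
  unfold Tet
  rw [hull_param v 0]
  simp only [Fin.succAbove_zero]
  rfl

lemma Xf_hasFDerivAt (v : Fin 4 → E3) (y : Fin 3 → ℝ) :
    HasFDerivAt (Xf v) (∑ j : Fin 3, (ContinuousLinearMap.proj (R := ℝ) (φ := fun _ : Fin 3 => ℝ) j).smulRight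
      (v j.succ - v 0)) y := by
  unfold Xf
  apply HasFDerivAt.const_add
  apply HasFDerivAt.fun_sum
  intro j _
  exact ((ContinuousLinearMap.proj (R := ℝ) (φ := fun _ : Fin 3 => ℝ) j).smulRight
      (v j.succ - v 0)).hasFDerivAt

lemma Xf_contDiff (v : Fin 4 → E3) : ContDiff ℝ 1 (Xf v) := by
  unfold Xf
  fun_prop

lemma Xf_ins_zero (v : Fin 4 → E3) (k : Fin 3) (w : Fin 2 → ℝ) :
    Xf v (ins k 0 w) = v 0 + ∑ j, w j • (v (k.succAbove j).succ - v 0) := by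
  simp [Xf, Fin.sum_univ_succAbove _ k, ins_same, ins_above]

lemma Xf_ins_one (v : Fin 4 → E3) (k : Fin 3) (w : Fin 2 → ℝ) :
    Xf v (ins k (1 - ∑ j, w j) w) =
      v k.succ + ∑ j, w j • (v (k.succAbove j).succ - v k.succ) := by
  simp only [Xf, Fin.sum_univ_succAbove _ k, ins_same, ins_above]
  simp only [Fin.sum_univ_two]
  module

lemma face_succ_integral (v : Fin 4 → E3) (hv : AffineIndependent ℝ v) {c : ℝ} (hc : 0 < c)
    (hH : (μH[2] : Measure E2) = ENNReal.ofReal c • volume) (k : Fin 3) (f : E3 → ℝ) :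
    ∫ x in Face v k.succ, f x ∂μH[2] =
      c * √(∑ m, Nn (fun j => v j.succ - v 0) k.succ m ^ 2) * ∫ w in SX 2, f (Xf v (ins k 0 w)) := by
  have hp := Nn_pos v hv k.succ
  rw [face_eq, hull_param _ 0]
  have := area_lemma hc hH (v 0) (fun j => v (k.succAbove j).succ - v 0) (SX 2)
    (isClosed_SX 2).measurableSet (√(∑ m, Nn (fun j => v j.succ - v 0) k.succ m ^ 2))
    (Real.sqrt_pos.2 hp) (by
      rw [Real.sq_sqrt hp.le]
      have := gram_k (fun j => v j.succ - v 0) k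
      simpa [Nn] using this) f
  simp only [Xf_ins_zero]
  rw [← this]
  simp

lemma face_zero_integral (v : Fin 4 → E3) (hv : AffineIndependent ℝ v) {c : ℝ} (hc : 0 < c)
    (hH : (μH[2] : Measure E2) = ENNReal.ofReal c • volume) (k : Fin 3) (f : E3 → ℝ) :
    ∫ x in Face v 0, f x ∂μH[2] =
      c * √(∑ m, Nn (fun j => v j.succ - v 0) 0 m ^ 2) *
        ∫ w in SX 2, f (Xf v (ins k (1 - ∑ j, w j) w)) := by
  have hp := Nn_pos v hv 0
  rw [face_eq, hull_param _ k]
  have := area_lemma hc hH (v k.succ) (fun j => v (k.succAbove j).succ - v k.succ) (SX 2)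
    (isClosed_SX 2).measurableSet (√(∑ m, Nn (fun j => v j.succ - v 0) 0 m ^ 2))
    (Real.sqrt_pos.2 hp) (by
      rw [Real.sq_sqrt hp.le]
      have := gram_0 (fun j => v j.succ - v 0) k
      simpa only [Nn, Fin.cons_zero, sub_sub_sub_cancel_right] using this) f
  simp only [Xf_ins_one]
  rw [← this]
  simp

/-- The flux density through the `k`-th coordinate. -/
def hk (v : Fin 4 → E3) (F : Fin 3 → E3 → ℝ) (k : Fin 3) (x : E3) : ℝ :=
  ∑ j, F j x * (Bm (fun j => v j.succ - v 0)).adjugate k j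

lemma hk_contDiff (v : Fin 4 → E3) (F : Fin 3 → E3 → ℝ) (hF : ∀ j, ContDiff ℝ 1 (F j)) (k : Fin 3) :
    ContDiff ℝ 1 (hk v F k) := by
  unfold hk
  exact ContDiff.sum fun j _ => (hF j).mul contDiff_const

lemma piola (v : Fin 4 → E3) (F : Fin 3 → E3 → ℝ) (hF : ∀ j, ContDiff ℝ 1 (F j)) (y : Fin 3 → ℝ) :
    ∑ k, fderiv ℝ (fun y => hk v F k (Xf v y)) y (Pi.single k 1) =
      (Bm (fun j => v j.succ - v 0)).det *
        ∑ j, fderiv ℝ (F j) (Xf v y) (EuclideanSpace.single j 1) := by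
  set b : Fin 3 → E3 := fun j => v j.succ - v 0 with hb
  have h1 : ∀ k, fderiv ℝ (fun y => hk v F k (Xf v y)) y (Pi.single k 1) =
      ∑ j, (Bm b).adjugate k j * fderiv ℝ (F j) (Xf v y) (b k) := by
    intro k
    have h : HasFDerivAt (hk v F k) (∑ j, (Bm b).adjugate k j • fderiv ℝ (F j) (Xf v y)) (Xf v y) := by
      unfold hk
      exact HasFDerivAt.fun_sum fun j _ =>
        (((hF j).differentiable one_ne_zero _).hasFDerivAt).mul_const _
    have h2 := h.comp y (Xf_hasFDerivAt v y)
    have h3 : fderiv ℝ (fun y => hk v F k (Xf v y)) y = _ := h2.fderiv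
    rw [h3]
    simp [Pi.single_apply, hb]
  have h2 : ∀ k, b k = ∑ m, b k m • (EuclideanSpace.single m (1:ℝ) : E3) := by
    intro k
    ext i
    simp [Pi.single_apply]
  have h3 : ∀ k j, fderiv ℝ (F j) (Xf v y) (b k) = 
      ∑ m, b k m * fderiv ℝ (F j) (Xf v y) (EuclideanSpace.single m 1) := by
    intro k j
    conv_lhs => rw [h2 k]
    simp
  simp only [h1, h3, Finset.mul_sum]
  rw [Finset.sum_comm]
  refine Finset.sum_congr rfl fun j _ => ?_
  rw [Finset.sum_comm]
  have h4 : ∀ m, ∑ k, (Bm b).adjugate k j * (b k m * fderiv ℝ (F j) (Xf v y) (EuclideanSpace.single m 1))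
      = (if m = j then (Bm b).det else 0) * fderiv ℝ (F j) (Xf v y) (EuclideanSpace.single m 1) := by
    intro m
    rw [← b_adj b m j, Finset.sum_mul]
    exact Finset.sum_congr rfl fun k _ => by ring
  simp [h4]

lemma continuous_ins (k : Fin 3) (t : (Fin 2 → ℝ) → ℝ) (ht : Continuous t) :
    Continuous (fun w => ins k (t w) w) := by
  refine continuous_pi fun i => ?_
  rcases Fin.eq_self_or_eq_succAbove k i with rfl | ⟨j, rfl⟩
  · simpa only [ins_same] using ht
  · simpa only [ins_above] using continuous_apply j

lemma flux (v : Fin 4 → E3) (hv : AffineIndependent ℝ v) {c : ℝ} (hc : 0 < c)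
    (hH : (μH[2] : Measure E2) = ENNReal.ofReal c • volume) (s : ℝ)
    (F : Fin 3 → E3 → ℝ) (hF : ∀ j, ContDiff ℝ 1 (F j)) :
    ∑ i : Fin 4, ∫ x in Face v i, (∑ j, F j x * nor v s i j) ∂μH[2] =
      c * s * ((Bm (fun j => v j.succ - v 0)).det * ∫ y in SX 3,
        ∑ j, fderiv ℝ (F j) (Xf v y) (EuclideanSpace.single j 1)) := by
  have hcont : ∀ k, Continuous (hk v F k) := fun k => (hk_contDiff v F hF k).continuous
  have hX : Continuous (Xf v) := (Xf_contDiff v).continuous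
  have hg : ∀ k, ContDiff ℝ 1 (fun y => hk v F k (Xf v y)) := fun k =>
    (hk_contDiff v F hF k).comp (Xf_contDiff v)
  have hI1 : ∀ k l, IntegrableOn (fun w => hk v F k (Xf v (ins l (1 - ∑ j, w j) w))) (SX 2) := fun k l =>
    ((hcont k).comp (hX.comp (continuous_ins l _ (by fun_prop)))).continuousOn.integrableOn_compact
      (isCompact_SX 2)
  have hI0 : ∀ k l, IntegrableOn (fun w => hk v F k (Xf v (ins l 0 w))) (SX 2) := fun k l =>
    ((hcont k).comp (hX.comp (continuous_ins l _ (by fun_prop)))).continuousOn.integrableOn_compact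
      (isCompact_SX 2)
  have e1 : ∀ k : Fin 3, ∫ x in Face v k.succ, (∑ j, F j x * nor v s k.succ j) ∂μH[2] =
      -(c * s * ∫ w in SX 2, hk v F k (Xf v (ins k 0 w))) := by
    intro k
    have hr : 0 < √(∑ m, Nn (fun j => v j.succ - v 0) k.succ m ^ 2) := Real.sqrt_pos.2 (Nn_pos v hv _)
    rw [face_succ_integral v hv hc hH k]
    have : ∀ x, (∑ j, F j x * nor v s k.succ j) =
        (-(s / √(∑ m, Nn (fun j => v j.succ - v 0) k.succ m ^ 2))) * hk v F k x := by
      intro x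
      rw [hk, Finset.mul_sum]
      refine Finset.sum_congr rfl fun j _ => ?_
      simp only [nor, Nn, Fin.cons_succ]
      ring
    simp only [this]
    rw [integral_const_mul]
    field_simp
  have e0 : ∫ x in Face v 0, (∑ j, F j x * nor v s 0 j) ∂μH[2] =
      c * s * ∑ k, ∫ w in SX 2, hk v F k (Xf v (ins k (1 - ∑ j, w j) w)) := by
    have hr : 0 < √(∑ m, Nn (fun j => v j.succ - v 0) 0 m ^ 2) := Real.sqrt_pos.2 (Nn_pos v hv _)
    have hsame : ∀ k, ∫ w in SX 2, hk v F k (Xf v (ins k (1 - ∑ j, w j) w)) =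
        ∫ w in SX 2, hk v F k (Xf v (ins 0 (1 - ∑ j, w j) w)) := by
      intro k
      have h1 := face_zero_integral v hv hc hH k (hk v F k)
      rw [face_zero_integral v hv hc hH 0 (hk v F k)] at h1
      exact (mul_left_cancel₀ (by positivity) h1).symm
    simp only [hsame]
    rw [← integral_finsetSum _ (fun k _ => hI1 k 0), face_zero_integral v hv hc hH 0]
    have : ∀ x, (∑ j, F j x * nor v s 0 j) =
        (s / √(∑ m, Nn (fun j => v j.succ - v 0) 0 m ^ 2)) * ∑ k, hk v F k x := by
      intro x
      simp only [hk]
      rw [Finset.sum_comm, Finset.mul_sum]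
      refine Finset.sum_congr rfl fun j _ => ?_
      rw [← Finset.mul_sum]
      simp only [nor, Nn, Fin.cons_zero]
      ring
    simp only [this]
    rw [integral_const_mul]
    field_simp
  rw [Fin.sum_univ_succ, e0]
  simp only [e1]
  rw [Finset.sum_neg_distrib, ← Finset.mul_sum, ← sub_eq_add_neg, ← mul_sub, ← Finset.sum_sub_distrib]
  congr 1
  rw [← integral_const_mul]
  simp only [← piola v F hF]
  rw [integral_finsetSum]
  · refine Finset.sum_congr rfl fun k _ => ?_
    rw [stokes _ (hg k) k, integral_sub (hI1 k k) (hI0 k k)]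
  · intro k _
    exact (((hg k).continuous_fderiv one_ne_zero).clm_apply continuous_const).continuousOn.integrableOn_compact
      (isCompact_SX 3)

/-- If `τ ∈ P₂(K;𝕊)` has row-wise divergence a rigid motion and the boundary
integral `∫_{∂K} τn · v ds` (a sum over the four faces, with their outward unit
normals) vanishes for every rigid motion `v`, then `div τ = 0` on `K`. -/
theorem stmt_12 (v : Fin 4 → E3) (hv : AffineIndependent ℝ v)
    (τ : E3 → Matrix (Fin 3) (Fin 3) ℝ)
    (hpoly : ∀ i j : Fin 3, IsPolyLE 2 (fun x => τ x i j))
    (hsymm : ∀ x ∈ Tet v, (τ x).IsSymm)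
    (hdiv : IsRigidOn (Tet v) (fun x r => divRow τ r x))
    (hbdry : ∀ n : Fin 4 → E3, (∀ i, IsOutwardNormal v i (n i)) →
      ∀ a b : Fin 3 → ℝ,
        (∑ i : Fin 4, ∫ x in Face v i,
          ((τ x).mulVec (fun r => n i r)) ⬝ᵥ (a + crossProduct b (fun m => x m)) ∂μH[2]) = 0) :
    ∀ x ∈ Tet v, ∀ r : Fin 3, divRow τ r x = 0 := by
  obtain ⟨c, hc, hH⟩ := exists_c
  obtain ⟨a, b, hab⟩ := hdiv
  have hτ : ∀ i j, ContDiff ℝ 1 (fun x => τ x i j) := fun i j => contDiff_of_isPolyLE (hpoly i j)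
  have hd := det_ne v hv
  obtain ⟨s, hs, hsd⟩ : ∃ s : ℝ, s ^ 2 = 1 ∧ 0 < s * (Bm (fun j => v j.succ - v 0)).det := by
    rcases lt_or_gt_of_ne hd with h | h
    · exact ⟨-1, by norm_num, by linarith⟩
    · exact ⟨1, by norm_num, by linarith⟩
  have h1 := hbdry (nor v s) (nor_outward v hv s hs hsd) a b
  have h2 : ∀ i x, ((τ x).mulVec (fun r => nor v s i r)) ⬝ᵥ (a + crossProduct b (fun m => x m)) =
      ∑ j, Ff τ a b j x * nor v s i j := by
    intro i x
    simp only [Ff, ← show qf a b x = a + crossProduct b (fun m => x m) from rfl, dotProduct,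
      Matrix.mulVec, Finset.sum_mul]
    rw [Finset.sum_comm]
    exact Finset.sum_congr rfl fun j _ => Finset.sum_congr rfl fun r _ => by ring
  simp only [h2] at h1
  rw [flux v hv hc hH s (Ff τ a b) (Ff_contDiff hτ a b)] at h1
  have hX : Continuous (Xf v) := (Xf_contDiff v).continuous
  have hmem : ∀ y ∈ SX 3, Xf v y ∈ Tet v := fun y hy => by
    rw [tet_eq]; exact ⟨y, hy, rfl⟩
  have h3 : ∫ y in SX 3, ∑ j, fderiv ℝ (Ff τ a b j) (Xf v y) (EuclideanSpace.single j 1) =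
      ∫ y in SX 3, ∑ r, qf a b (Xf v y) r ^ 2 := by
    refine setIntegral_congr_fun (isClosed_SX 3).measurableSet fun y hy => ?_
    show _ = _
    rw [div_Ff hτ a b _ (hsymm _ (hmem y hy))]
    refine Finset.sum_congr rfl fun r _ => ?_
    have := congrFun (hab _ (hmem y hy)) r
    rw [sq]
    congr 1
  have h4 : ∫ y in SX 3, ∑ r, qf a b (Xf v y) r ^ 2 = 0 := by
    rw [h3, ← mul_assoc, mul_assoc c] at h1
    exact (mul_eq_zero.1 h1).resolve_left (by positivity)
  have hcq : Continuous (fun y => ∑ r, qf a b (Xf v y) r ^ 2) :=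
    continuous_finsetSum _ fun r _ => (((qf_contDiff a b r).continuous).comp hX).pow 2
  have h5 := (setIntegral_eq_zero_iff_of_nonneg_ae
    (Filter.Eventually.of_forall fun y => Finset.sum_nonneg fun r _ => sq_nonneg _)
    (hcq.continuousOn.integrableOn_compact (isCompact_SX 3))).1 h4
  have h6 := Measure.eqOn_of_ae_eq h5 hcq.continuousOn continuousOn_const SX3_subset
  intro x hx r
  have h7 := congrFun (hab x hx) r
  rw [tet_eq] at hx
  obtain ⟨y, hy, rfl⟩ := hx
  have h8 := (Finset.sum_eq_zero_iff_of_nonneg (fun r _ => sq_nonneg _)).1 (h6 hy) r (Finset.mem_univ r)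
  exact h7.trans (pow_eq_zero_iff two_ne_zero |>.1 h8)
end
end
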